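/- arXiv:1101.2145 — 3 statements merged into one kernel-verified Lean document; each statement's English description precedes it below -/
import Mathlib

section
/- Cook-type existence of strong limits, Krein-unitary target with uniformly positive range (Proposition D.3(2)). Let K be a bounded selfadjoint operator on H with 1+K boundedly invertible, and [u,v] := ⟨u, (1+K) v⟩ the associated Krein form. Assume that every U1(t) is unitary for the Krein form ([U1(t)u, U1(t)v] = [u,v] for all u, v, t), and that there is c > 0 such that [w, w] ≥ c ‖w‖² for every w in the closure of the range of P1. Assume furthermore: (a) for all u, v ∈ H the function g_{v,u}(t) := [U1(t)v, P1 M(t) P0 U0(t) u] is differentiable on [0,∞) with |g_{v,u}'(t)| ≤ Σ_{i=1}^{N} ‖B1_i(t) P1 U1(t) v‖ · ‖B0_i(t) P0 U0(t) u‖; (b) there is C > 0 such that ∫_0^∞ ‖B1_i(t) P1 U1(t) v‖² dt ≤ C ‖v‖² and ∫_0^∞ ‖B0_i(t) P0 U0(t) u‖² dt ≤ C ‖u‖² for all u, v ∈ H and all i. Then for every u ∈ H the vectors U1(t)^{-1} P1 M(t) P0 U0(t) u converge in the norm of H as t → +∞; that is, the strong limit s-lim_{t→+∞} U1(t)^{-1}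 P1 M(t) P0 U0(t) exists. -/
open MeasureTheory Set Filter
open scoped ComplexInnerProductSpace Topology

theorem cook_aux_cont {H : Type*} [NormedAddCommGroup H] [InnerProductSpace ℂ H] [CompleteSpace H]
    (B : ℝ → H →L[ℂ] H) (hB : ∀ u, Continuous fun t => B t u) (x : ℝ → H) (hx : Continuous x) :
    Continuous fun t => B t (x t) := by
  rw [continuous_iff_continuousAt]
  intro t0
  obtain ⟨C, hC⟩ : ∃ C, ∀ t : Icc (t0 - 1) (t0 + 1), ‖B t‖ ≤ C := by
    apply banach_steinhaus
    intro y
    obtain ⟨C, hC⟩ := (isCompact_Icc (a := t0 - 1) (b := t0 + 1)).exists_bound_of_continuousOn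
      (hB y).continuousOn
    exact ⟨C, fun t => hC t t.2⟩
  have h1 : Tendsto (fun t => B t (x t - x t0)) (𝓝 t0) (𝓝 0) := by
    have h2 : Tendsto (fun t => C * ‖x t - x t0‖) (𝓝 t0) (𝓝 0) := by
      have : Continuous (fun t => C * ‖x t - x t0‖) := by fun_prop
      simpa using this.tendsto t0
    apply squeeze_zero_norm' _ h2
    filter_upwards [Icc_mem_nhds (show t0 - 1 < t0 by linarith) (show t0 < t0 + 1 by linarith)]
      with t ht
    exact (B t).le_of_opNorm_le (hC ⟨t, ht⟩) _
  have h3 := h1.add ((hB (x t0)).tendsto t0)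
  simpa [ContinuousAt] using h3

theorem cook_aux_int (f : ℝ → ℝ) (hf : Continuous f) (h0 : ∀ t, 0 ≤ f t) (D : ℝ) (hD : 0 ≤ D)
    (h : ∫⁻ t in Ioi (0:ℝ), ENNReal.ofReal (f t) ≤ ENNReal.ofReal D) (a b : ℝ) (ha : 0 ≤ a)
    (hab : a ≤ b) : ∫ t in a..b, f t ≤ D := by
  rw [intervalIntegral.integral_of_le hab,
    integral_eq_lintegral_of_nonneg_ae (Eventually.of_forall h0) hf.aestronglyMeasurable]
  apply ENNReal.toReal_le_of_le_ofReal hD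
  refine le_trans (lintegral_mono_set ?_) h
  intro t ht
  exact lt_of_le_of_lt ha ht.1

theorem cook_aux_sum {H : Type*} [NormedAddCommGroup H] [InnerProductSpace ℂ H] [CompleteSpace H]
    (N : ℕ) (B : Fin N → ℝ → H →L[ℂ] H)
    (hB : ∀ (i : Fin N) (u : H), ContinuousOn (fun t : ℝ => B i t u) (Ici 0))
    (P : H →L[ℂ] H) (U : ℝ → H →L[ℂ] H) (v : H) (hU : Continuous fun t => U t v)
    (D : ℝ) (hD : 0 ≤ D)
    (hb : ∀ i : Fin N, ∫⁻ t in Ioi (0:ℝ), ENNReal.ofReal (‖B i t (P (U t v))‖ ^ 2)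
        ≤ ENNReal.ofReal D) :
    ∃ f : ℝ → ℝ, Continuous f ∧ (∀ t, 0 ≤ f t) ∧
      (∀ t, 0 ≤ t → f t = ∑ i, ‖B i t (P (U t v))‖ ^ 2) ∧
      ∀ a b, 0 ≤ a → a ≤ b → ∫ t in a..b, f t ≤ N * D := by
  have hc : ∀ i, Continuous fun t : ℝ => ‖B i (max t 0) (P (U t v))‖ ^ 2 := by
    intro i
    have := cook_aux_cont (fun t => B i (max t 0))
      (fun u => (hB i u).comp_continuous (by fun_prop) (fun t => le_max_right t 0))
      (fun t => P (U t v)) (by fun_prop)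
    exact this.norm.pow 2
  refine ⟨fun t => ∑ i, ‖B i (max t 0) (P (U t v))‖ ^ 2, continuous_finsetSum _ (fun i _ => hc i), fun t => by positivity,
    fun t ht => by simp [max_eq_left ht], ?_⟩
  intro a b ha hab
  rw [intervalIntegral.integral_finsetSum (fun i _ => (hc i).intervalIntegrable _ _)]
  calc _ ≤ ∑ i : Fin N, D := by
        apply Finset.sum_le_sum
        intro i _
        apply cook_aux_int _ (hc i) (fun t => by positivity) D hD _ a b ha hab
        refine le_trans (le_of_eq ?_) (hb i)
        apply setLIntegral_congr_fun measurableSet_Ioi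
        intro t ht
        simp only [max_eq_left (le_of_lt (mem_Ioi.1 ht))]
    _ = _ := by simp

/-- **Cook-type existence of strong limits, Krein-unitary target with uniformly positive
range** (Proposition D.3(2)). -/
theorem cook_argument_krein_target
    {H : Type*} [NormedAddCommGroup H] [InnerProductSpace ℂ H] [CompleteSpace H]
    (U0 U1 : ℝ → H →L[ℂ] H)
    -- U0 : strongly continuous unitary group
    (hU00 : U0 0 = 1) (hU0grp : ∀ s t : ℝ, U0 (s + t) = (U0 s).comp (U0 t))
    (hU0cont : ∀ u : H, Continuous fun t : ℝ => U0 t u)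
    (hU0unitary : ∀ (t : ℝ) (u v : H), ⟪U0 t u, U0 t v⟫ = ⟪u, v⟫)
    -- U1 : strongly continuous group of bounded (invertible) operators
    (hU10 : U1 0 = 1) (hU1grp : ∀ s t : ℝ, U1 (s + t) = (U1 s).comp (U1 t))
    (hU1cont : ∀ u : H, Continuous fun t : ℝ => U1 t u)
    (P0 P1 : H →L[ℂ] H)
    (hP0 : ∀ t : ℝ, P0.comp (U0 t) = (U0 t).comp P0)
    (hP1 : ∀ t : ℝ, P1.comp (U1 t) = (U1 t).comp P1)
    (M : ℝ → H →L[ℂ] H)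
    (hMcont : ∀ u : H, ContinuousOn (fun t : ℝ => M t u) (Ici 0))
    (N : ℕ) (B0 B1 : Fin N → ℝ → H →L[ℂ] H)
    (hB0cont : ∀ (i : Fin N) (u : H), ContinuousOn (fun t : ℝ => B0 i t u) (Ici 0))
    (hB1cont : ∀ (i : Fin N) (u : H), ContinuousOn (fun t : ℝ => B1 i t u) (Ici 0))
    -- the Krein structure
    (K : H →L[ℂ] H) (hK : IsSelfAdjoint K)
    (hKunit : IsUnit ((1 : H →L[ℂ] H) + K))
    -- every U1(t) is Krein unitary
    (hU1krein : ∀ (t : ℝ) (u v : H),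
      ⟪U1 t u, ((1 : H →L[ℂ] H) + K) (U1 t v)⟫ = ⟪u, ((1 : H →L[ℂ] H) + K) v⟫)
    -- uniform positivity on the closure of the range of P1
    (c : ℝ) (hcpos : 0 < c)
    (hpos : ∀ w ∈ closure (Set.range (⇑P1)),
      c * ‖w‖ ^ 2 ≤ (⟪w, ((1 : H →L[ℂ] H) + K) w⟫).re)
    -- (a) differentiability and bound on the derivative
    (ha : ∀ u v : H, ∀ t ∈ Ici (0:ℝ), ∃ d : ℂ,
      HasDerivWithinAt
        (fun s : ℝ => ⟪U1 s v, ((1 : H →L[ℂ] H) + K) (P1 (M s (P0 (U0 s u))))⟫)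
        d (Ici 0) t ∧
      ‖d‖ ≤ ∑ i : Fin N, ‖B1 i t (P1 (U1 t v))‖ * ‖B0 i t (P0 (U0 t u))‖)
    -- (b) integral propagation estimates
    (Cc : ℝ) (hCc : 0 < Cc)
    (hb1 : ∀ (v : H) (i : Fin N),
      ∫⁻ t in Ioi (0:ℝ), ENNReal.ofReal (‖B1 i t (P1 (U1 t v))‖ ^ 2)
        ≤ ENNReal.ofReal (Cc * ‖v‖ ^ 2))
    (hb0 : ∀ (u : H) (i : Fin N),
      ∫⁻ t in Ioi (0:ℝ), ENNReal.ofReal (‖B0 i t (P0 (U0 t u))‖ ^ 2)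
        ≤ ENNReal.ofReal (Cc * ‖u‖ ^ 2)) :
    ∀ u : H, ∃ w : H,
      Tendsto (fun t : ℝ => U1 (-t) (P1 (M t (P0 (U0 t u))))) atTop (𝓝 w) := by
  intro u
  set w : ℝ → H := fun t => U1 (-t) (P1 (M t (P0 (U0 t u)))) with hw
  obtain ⟨f0, f0c, f0n, f0e, f0i⟩ := cook_aux_sum N B0 hB0cont P0 U0 u (hU0cont u) (Cc * ‖u‖ ^ 2)
    (by positivity) (hb0 u)
  set δ : ℝ := c / (N * Cc + 1) with hδ
  have hδp : 0 < δ := by positivity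
  have hδN : δ * (N * Cc) ≤ c := by
    rw [hδ, div_mul_eq_mul_div, div_le_iff₀ (by positivity)]
    nlinarith
  have hwg : ∀ v t, ⟪v, ((1 : H →L[ℂ] H) + K) (w t)⟫
      = ⟪U1 t v, ((1 : H →L[ℂ] H) + K) (P1 (M t (P0 (U0 t u))))⟫ := by
    intro v t
    rw [← hU1krein t v (w t)]
    have : U1 t (w t) = P1 (M t (P0 (U0 t u))) := by
      have h := hU1grp t (-t)
      rw [add_neg_cancel, hU10] at h
      have h2 := congrArg (fun L : H →L[ℂ] H => L (P1 (M t (P0 (U0 t u))))) h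
      simpa using h2.symm
    rw [this]
  have hwr : ∀ t, ∃ y, P1 y = w t := by
    intro t
    refine ⟨U1 (-t) (M t (P0 (U0 t u))), ?_⟩
    have h2 := congrArg (fun L : H →L[ℂ] H => L (M t (P0 (U0 t u)))) (hP1 (-t))
    simpa using h2
  have key : ∀ s t, 0 ≤ s → s ≤ t → ‖w t - w s‖ ^ 2 ≤ (1 / (c * δ)) * ∫ r in s..t, f0 r := by
    intro s t hs hst
    set v := w t - w s with hv
    obtain ⟨f1, f1c, f1n, f1e, f1i⟩ := cook_aux_sum N B1 hB1cont P1 U1 v (hU1cont v)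
      (Cc * ‖v‖ ^ 2) (by positivity) (hb1 v)
    have hp : c * ‖v‖ ^ 2 ≤ (⟪v, ((1 : H →L[ℂ] H) + K) v⟫).re := by
      apply hpos
      apply subset_closure
      obtain ⟨y, hy⟩ := hwr t
      obtain ⟨z, hz⟩ := hwr s
      exact ⟨y - z, by rw [map_sub, hy, hz]⟩
    choose! d hd hdb using ha u v
    set g := (fun s : ℝ => ⟪U1 s v, ((1 : H →L[ℂ] H) + K) (P1 (M s (P0 (U0 s u))))⟫) with hg
    have hφc : Continuous fun r => (δ * f1 r + δ⁻¹ * f0 r) / 2 := by fun_prop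
    have hgb : ‖g t - g s‖ ≤ ∫ r in s..t, (δ * f1 r + δ⁻¹ * f0 r) / 2 := by
      refine image_norm_le_of_norm_deriv_right_le_deriv_boundary
        (f := fun x => g x - g s) (f' := d) (a := s) (b := t)
        (B := fun x => ∫ r in s..x, (δ * f1 r + δ⁻¹ * f0 r) / 2)
        (B' := fun r => (δ * f1 r + δ⁻¹ * f0 r) / 2) ?_ ?_ ?_ ?_ ?_ (right_mem_Icc.2 hst)
      · intro x hx
        have h0x : (0:ℝ) ≤ x := hs.trans hx.1
        exact (((hd x h0x).continuousWithinAt).mono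
          (fun y hy => hs.trans hy.1)).sub continuousWithinAt_const
      · intro x hx
        have h0x : (0:ℝ) ≤ x := hs.trans hx.1
        exact ((hd x h0x).mono (fun y hy => h0x.trans hy)).sub_const _
      · simp
      · intro x
        exact hφc.integral_hasStrictDerivAt s x |>.hasDerivAt
      · intro x hx
        have h0x : (0:ℝ) ≤ x := hs.trans hx.1
        refine (hdb x h0x).trans ?_
        rw [f1e x h0x, f0e x h0x, Finset.mul_sum, Finset.mul_sum, ← Finset.sum_add_distrib,
          Finset.sum_div]
        apply Finset.sum_le_sum
        intro i _
        generalize ‖B1 i x (P1 (U1 x v))‖ = p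
        generalize ‖B0 i x (P0 (U0 x u))‖ = q
        have : (δ * p ^ 2 + δ⁻¹ * q ^ 2) / 2 - p * q = δ⁻¹ * (δ * p - q) ^ 2 / 2 := by
          field_simp
          ring
        have h2 : 0 ≤ δ⁻¹ * (δ * p - q) ^ 2 / 2 := by positivity
        linarith
    have hsplit : ∫ r in s..t, (δ * f1 r + δ⁻¹ * f0 r) / 2
        = (δ * (∫ r in s..t, f1 r) + δ⁻¹ * ∫ r in s..t, f0 r) / 2 := by
      rw [intervalIntegral.integral_div, intervalIntegral.integral_add
        ((by fun_prop : Continuous fun r => δ * f1 r).intervalIntegrable _ _)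
        ((by fun_prop : Continuous fun r => δ⁻¹ * f0 r).intervalIntegrable _ _),
        intervalIntegral.integral_const_mul, intervalIntegral.integral_const_mul]
    have hinner : ⟪v, ((1 : H →L[ℂ] H) + K) v⟫ = g t - g s := by
      rw [hg]
      simp only
      rw [← hwg, ← hwg, ← inner_sub_right, ← map_sub]
    have h1 := f1i s t hs hst
    have h2 : c * ‖v‖ ^ 2 ≤ (δ * (∫ r in s..t, f1 r) + δ⁻¹ * ∫ r in s..t, f0 r) / 2 := by
      rw [← hsplit]
      rw [hinner] at hp
      exact hp.trans ((Complex.re_le_norm _).trans hgb)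
    have h3 : δ * (∫ r in s..t, f1 r) ≤ c * ‖v‖ ^ 2 := by
      calc _ ≤ δ * (N * (Cc * ‖v‖ ^ 2)) := by gcongr
        _ = δ * (N * Cc) * ‖v‖ ^ 2 := by ring
        _ ≤ _ := by gcongr
    have h4 : c * ‖v‖ ^ 2 ≤ δ⁻¹ * ∫ r in s..t, f0 r := by linarith
    calc ‖v‖ ^ 2 = c⁻¹ * (c * ‖v‖ ^ 2) := by field_simp
      _ ≤ c⁻¹ * (δ⁻¹ * ∫ r in s..t, f0 r) := by gcongr
      _ = _ := by
        field_simp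
  have hii : ∀ a b, IntervalIntegrable f0 volume a b := fun a b => f0c.intervalIntegrable a b
  have hsub : ∀ s t, ∫ r in s..t, f0 r = (∫ r in (0:ℝ)..t, f0 r) - ∫ r in (0:ℝ)..s, f0 r :=
    fun s t => (intervalIntegral.integral_interval_sub_left (hii _ _) (hii _ _)).symm
  have hmono : Monotone fun t => ∫ r in (0:ℝ)..t, f0 r := by
    intro s t hst
    have := intervalIntegral.integral_nonneg (μ := volume) hst (fun r _ => f0n r)
    rw [hsub] at this
    simpa using this
  have hbdd : BddAbove (range fun t => ∫ r in (0:ℝ)..t, f0 r) := by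
    refine ⟨N * (Cc * ‖u‖ ^ 2), ?_⟩
    rintro _ ⟨t, rfl⟩
    exact (hmono (le_max_left t 0)).trans (f0i 0 _ le_rfl (le_max_right t 0))
  have hF := (tendsto_atTop_ciSup hmono hbdd).cauchySeq
  apply cauchySeq_tendsto_of_complete
  rw [Metric.cauchySeq_iff'] at hF ⊢
  intro ε hε
  obtain ⟨T, hT⟩ := hF (c * δ * ε ^ 2 / 2) (by positivity)
  refine ⟨max T 0, fun t ht => ?_⟩
  have hk := key (max T 0) t (le_max_right _ _) ht
  have h1 := hT t ((le_max_left _ _).trans ht)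
  have h2 := hmono (le_max_left T 0)
  rw [Real.dist_eq] at h1
  have h3 := (abs_lt.1 h1).2
  have h4 : ∫ r in (max T 0)..t, f0 r < c * δ * ε ^ 2 := by
    rw [hsub]
    have : 0 < c * δ * ε ^ 2 := by positivity
    simp only at h2
    linarith
  have h5 : ‖w t - w (max T 0)‖ ^ 2 < ε ^ 2 := by
    refine hk.trans_lt ?_
    rw [one_div, inv_mul_lt_iff₀ (by positivity)]
    exact h4
  rw [dist_eq_norm]
  exact lt_of_pow_lt_pow_left₀ 2 hε.le h5
end

section
/- Smooth functional calculus via almost analytic extensions, convergence and independence (Proposition B.5(1)). Let ρ < 0, let f ∈ S^ρ(ℝ), let N ≥ m+1, let χ ∈ C_c^∞(ℝ) with χ ≡ 1 on [−1/2, 1/2] and supp χ ⊂ [−1, 1], and let δ' > 0 be small enough that {x + iy : 0 < |y| ≤ δ'⟨x⟩} ⊂ U(R, a, δ). Define the almost analytic extension f̃(x+iy) := (Σ_{r=0}^{N} f^{(r)}(x) (iy)^r / r!) · χ(y / (δ'⟨x⟩)). Then the integral f(A) := (1/π) ∫_ℂ ∂̄f̃(z) (z − A)^{−1} dλ(z),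 where ∂̄ = (∂_x + i ∂_y)/2 and λ is Lebesgue measure on ℂ ≅ ℝ² (equivalently f(A) = (i/2π) ∫_ℂ (∂f̃/∂z̄)(z) (z − A)^{−1} dz ∧ dz̄), converges absolutely in operator norm, and the resulting bounded operator f(A) is independent of the admissible choices of N ≥ m+1, δ' and χ. -/
open MeasureTheory
open scoped ComplexInnerProductSpace

noncomputable section

/-- The Japanese bracket `⟨x⟩ = (1 + x²)^{1/2}`. -/
def jbrack (x : ℝ) : ℝ := Real.sqrt (1 + x ^ 2)

/-- The symbol class `S^ρ(ℝ)`: smooth functions with `|f^{(α)}(λ)| ≤ C_α ⟨λ⟩^{ρ-α}`. -/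
def SclassC (ρ : ℝ) (f : ℝ → ℂ) : Prop :=
  ContDiff ℝ (⊤ : ℕ∞) f ∧
    ∀ α : ℕ, ∃ C : ℝ, ∀ x : ℝ, ‖iteratedDeriv α f x‖ ≤ C * jbrack x ^ (ρ - (α : ℝ))

/-- An admissible cutoff function: smooth, compactly supported, `χ ≡ 1` on `[-1/2, 1/2]`,
`supp χ ⊆ [-1, 1]`. -/
def AdmissibleCutoff (χ : ℝ → ℝ) : Prop :=
  ContDiff ℝ (⊤ : ℕ∞) χ ∧ HasCompactSupport χ ∧
    (∀ s : ℝ, |s| ≤ 1 / 2 → χ s = 1) ∧ ∀ s : ℝ, 1 < |s| → χ s = 0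

/-- The almost analytic extension
`f̃(x+iy) = (Σ_{r=0}^{N} f^{(r)}(x)(iy)^r/r!) χ(y/(δ'⟨x⟩))`. -/
def aaExt (N : ℕ) (δ' : ℝ) (χ : ℝ → ℝ) (f : ℝ → ℂ) (z : ℂ) : ℂ :=
  (∑ r ∈ Finset.range (N + 1),
      iteratedDeriv r f z.re * (Complex.I * (z.im : ℂ)) ^ r / (r.factorial : ℂ)) *
    (χ (z.im / (δ' * jbrack z.re)) : ℂ)

/-- `∂̄g = (∂_x g + i ∂_y g)/2` for `g : ℂ → ℂ`, computed via the real Fréchet derivative. -/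
def dbar (g : ℂ → ℂ) (z : ℂ) : ℂ :=
  (fderiv ℝ g z 1 + Complex.I * fderiv ℝ g z Complex.I) / 2

/-- The region `U0(R, a) = {0 < |Im z| < a, |Re z| ≤ R}`. -/
def U0set (R a : ℝ) : Set ℂ := {z : ℂ | 0 < |z.im| ∧ |z.im| < a ∧ |z.re| ≤ R}

/-- The region `U∞(R, δ) = {0 < |Im z| ≤ δ |Re z|, |Re z| ≥ R}`. -/
def UinfSet (R δ : ℝ) : Set ℂ := {z : ℂ | 0 < |z.im| ∧ |z.im| ≤ δ * |z.re| ∧ R ≤ |z.re|}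

/-- The region `U(R, a, δ) = U0(R, a) ∪ U∞(R, δ)`. -/
def Uset (R a δ : ℝ) : Set ℂ := U0set R a ∪ UinfSet R δ

open Filter Topology in
lemma aux_ae_lineDeriv_zero {g : ℂ → ℂ} (hg : ContDiff ℝ 1 g) (v : ℂ) :
    ∀ᵐ z : ℂ, g z = 0 → fderiv ℝ g z v = 0 := by
  have hd : Differentiable ℝ g := hg.differentiable (by norm_num)
  have hc : Continuous (fun z => fderiv ℝ g z v) :=
    (hg.continuous_fderiv (by norm_num)).clm_apply continuous_const
  let S : Set ℂ := {z | g z = 0 → fderiv ℝ g z v = 0}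
  have hS : MeasurableSet S := by
    have : S = {z | g z = 0}ᶜ ∪ {z | fderiv ℝ g z v = 0} := by
      ext z; simp [S, imp_iff_not_or]
    rw [this]
    exact ((isClosed_eq hg.continuous continuous_const).measurableSet.compl).union
      (isClosed_eq hc continuous_const).measurableSet
  let L : ℝ →ₗ[ℝ] ℂ := LinearMap.toSpanSingleton ℝ ℂ v
  refine MeasureTheory.ae_mem_of_ae_add_linearMap_mem L volume volume hS ?_
  intro y
  have hder : ∀ t : ℝ, HasDerivAt (fun t : ℝ => g (y + t • v)) (fderiv ℝ g (y + t • v) v) t := by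
    intro t
    have h1 : HasDerivAt (fun t : ℝ => y + t • v) v t := by
      simpa using ((hasDerivAt_id t).smul_const v).const_add y
    exact (hd (y + t • v)).hasFDerivAt.comp_hasDerivAt t h1
  have hcount : {t : ℝ | g (y + t • v) = 0 ∧ fderiv ℝ g (y + t • v) v ≠ 0}.Countable := by
    apply IsLindelof.countable
    · exact HereditarilyLindelofSpace.isLindelof _
    · rw [discreteTopology_subtype_iff]
      rintro t ⟨ht0, ht1⟩
      have := (hder t).eventually_ne ht1 (c := 0)
      rw [← _root_.disjoint_iff, Filter.disjoint_principal_right]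
      filter_upwards [this] with s hs hs'
      exact hs hs'.1
  have := hcount.ae_notMem volume
  filter_upwards [this] with t ht
  change g (y + t • v) = 0 → fderiv ℝ g (y + t • v) v = 0
  intro h0
  by_contra h1
  exact ht ⟨h0, h1⟩

lemma aux_clm_ext {L : ℂ →L[ℝ] ℂ} (h1 : L 1 = 0) (hI : L Complex.I = 0) : L = 0 := by
  ext z
  have hz : z = z.re • (1:ℂ) + z.im • Complex.I := by
    simp [Complex.re_add_im]
  rw [hz, map_add, map_smul, map_smul, h1, hI]; simp

lemma aux_ae_fderiv_zero {g : ℂ → ℂ} (hg : ContDiff ℝ 1 g) :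
    ∀ᵐ z : ℂ, g z = 0 → fderiv ℝ g z = 0 := by
  filter_upwards [aux_ae_lineDeriv_zero hg 1, aux_ae_lineDeriv_zero hg Complex.I] with z h1 h2 h
  exact aux_clm_ext (h1 h) (h2 h)

lemma aux_integral_fderiv_zero {E : Type*} [NormedAddCommGroup E] [NormedSpace ℝ E]
    {G : ℂ → E} (hG : ContDiff ℝ 1 G) (hc : HasCompactSupport G) (v : ℂ) :
    Integrable (fun z => fderiv ℝ G z v) ∧ ∫ z : ℂ, fderiv ℝ G z v = 0 := by
  have hcd : Continuous (fun z => fderiv ℝ G z v) :=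
    (hG.continuous_fderiv (by norm_num)).clm_apply continuous_const
  have hs : HasCompactSupport (fun z => fderiv ℝ G z v) := hc.fderiv_apply ℝ v
  have hi : Integrable (fun z => fderiv ℝ G z v) := hcd.integrable_of_hasCompactSupport hs
  refine ⟨hi, ?_⟩
  have := integral_smul_fderiv_eq_neg_fderiv_smul_of_integrable (𝕜 := ℝ) (μ := (volume : Measure ℂ))
    (f := fun _ : ℂ => (1:ℝ)) (g := G) (v := v) (by simp) (by simpa using hi)
    (by simpa using hG.continuous.integrable_of_hasCompactSupport hc) (by simp)
    (fun x _ => hG.differentiable (by norm_num) x)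
  simpa using this

lemma aux_dbar_norm_le (g : ℂ → ℂ) (z : ℂ) : ‖dbar g z‖ ≤ ‖fderiv ℝ g z‖ := by
  unfold dbar
  rw [norm_div]
  have h1 := (fderiv ℝ g z).le_opNorm 1
  have h2 := (fderiv ℝ g z).le_opNorm Complex.I
  have h3 := norm_add_le (fderiv ℝ g z 1) (Complex.I * fderiv ℝ g z Complex.I)
  simp at h1 h2 h3 ⊢
  linarith

lemma aux_continuous_dbar {g : ℂ → ℂ} (hg : ContDiff ℝ 1 g) : Continuous (dbar g) := by
  have hcd : ∀ v, Continuous (fun z => fderiv ℝ g z v) := fun v =>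
    (hg.continuous_fderiv (by norm_num)).clm_apply continuous_const
  unfold dbar
  have h1 := hcd 1
  have h2 := hcd Complex.I
  fun_prop

lemma aux_compact {E : Type*} [NormedAddCommGroup E] [NormedSpace ℂ E] [CompleteSpace E]
    {V : Set ℂ} (hV : IsOpen V) {F : ℂ → E} (hF : DifferentiableOn ℂ F V)
    {h : ℂ → ℂ} (hh : ContDiff ℝ 1 h) (hc : HasCompactSupport h) (hsub : tsupport h ⊆ V) :
    Integrable (fun z => dbar h z • F z) ∧ ∫ z : ℂ, dbar h z • F z = 0 := by
  have hG : ContDiff ℝ 1 (fun z => h z • F z) := by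
    rw [contDiff_iff_contDiffAt]
    intro z
    by_cases hz : z ∈ tsupport h
    · have : ContDiffAt ℂ 1 F z := (hF.analyticAt (hV.mem_nhds (hsub hz))).contDiffAt
      exact hh.contDiffAt.smul (this.restrict_scalars ℝ)
    · have : (fun z => h z • F z) =ᶠ[nhds z] fun _ => 0 := by
        filter_upwards [(notMem_tsupport_iff_eventuallyEq.mp hz)] with w hw
        simp [hw]
      exact contDiffAt_const.congr_of_eventuallyEq this
  have hGc : HasCompactSupport (fun z => h z • F z) := hc.smul_right
  obtain ⟨i1, e1⟩ := aux_integral_fderiv_zero hG hGc 1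
  obtain ⟨i2, e2⟩ := aux_integral_fderiv_zero hG hGc Complex.I
  have key : (fun z => dbar h z • F z) = fun z => (2⁻¹ : ℂ) • (fderiv ℝ (fun z => h z • F z) z 1 +
      Complex.I • fderiv ℝ (fun z => h z • F z) z Complex.I) := by
    funext z
    by_cases hz : z ∈ tsupport h
    · have hFz := (hF.differentiableAt (hV.mem_nhds (hsub hz))).hasFDerivAt
      have hFr := hFz.restrictScalars ℝ
      have hhz := (hh.differentiable (by norm_num) z).hasFDerivAt
      have hfe : fderiv ℝ (fun z => h z • F z) z = _ := (hhz.smul hFr).fderiv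
      rw [hfe]
      have : fderiv ℂ F z Complex.I = Complex.I • fderiv ℂ F z 1 := by
        rw [← map_smul]; simp
      simp only [add_apply, smul_apply,
        ContinuousLinearMap.smulRight_apply, ContinuousLinearMap.coe_restrictScalars', this, dbar]
      simp only [smul_add, smul_smul, div_eq_mul_inv]
      have h4 : (2⁻¹ * (Complex.I * (h z * Complex.I))) = - (2⁻¹ * h z) := by
        linear_combination (2⁻¹ * h z) * Complex.I_mul_I
      rw [h4]
      module
    · have e : fderiv ℝ h z = 0 := by
        by_contra hne
        exact hz (support_fderiv_subset ℝ (f := h) hne)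
      have e' : fderiv ℝ (fun z => h z • F z) z = 0 := by
        have : (fun z => h z • F z) =ᶠ[nhds z] fun _ => 0 := by
          filter_upwards [(notMem_tsupport_iff_eventuallyEq.mp hz)] with w hw
          simp [hw]
        rw [this.fderiv_eq]; simp
      simp [e', dbar, e]
  rw [key]
  refine ⟨(i1.add (i2.smul Complex.I)).smul _, ?_⟩
  have i2' : Integrable (fun z => Complex.I • fderiv ℝ (fun z => h z • F z) z Complex.I) := i2.smul Complex.I
  rw [integral_smul, integral_add i1 i2', integral_smul, e1, e2]
  simp

/-- a smooth truncation of the identity -/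
lemma aux_trunc : ∃ Φ : ℂ → ℂ, ContDiff ℝ 1 Φ ∧ (∀ w, ‖w‖ ≤ 1 → Φ w = 0) ∧
    (∀ w, 2 ≤ ‖w‖ → Φ w = w) ∧ ∃ C, 0 ≤ C ∧ ∀ w, ‖fderiv ℝ Φ w‖ ≤ C := by
  let b : ContDiffBump (0:ℂ) := ⟨1, 2, by norm_num, by norm_num⟩
  have hb : ContDiff ℝ 1 (b : ℂ → ℝ) := b.contDiff
  have hΦ : ContDiff ℝ 1 (fun w : ℂ => (1 - b w) • w) := (contDiff_const.sub hb).smul contDiff_id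
  refine ⟨fun w => (1 - b w) • w, hΦ, ?_, ?_, ?_⟩
  · intro w hw
    have : b w = 1 := b.one_of_mem_closedBall (by simpa [b] using hw)
    simp [this]
  · intro w hw
    have : b w = 0 := b.zero_of_le_dist (by simpa [b] using hw)
    simp [this]
  · have hc : HasCompactSupport (fun w : ℂ => b w • w) := b.hasCompactSupport.smul_right
    have hd : ContDiff ℝ 1 (fun w : ℂ => b w • w) := hb.smul contDiff_id
    have hcont := hd.continuous_fderiv (by norm_num)
    obtain ⟨C, hC⟩ := hcont.bounded_above_of_compact_support (hc.fderiv ℝ)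
    refine ⟨1 + C, by linarith [(norm_nonneg _).trans (hC 0)], fun w => ?_⟩
    have e : (fun w : ℂ => (1 - b w) • w) = fun w => w - b w • w := by
      funext w; rw [sub_smul, one_smul]
    rw [e, fderiv_fun_sub differentiableAt_fun_id (hd.differentiable (by norm_num) w)]
    refine (norm_sub_le _ _).trans (add_le_add ?_ (hC w))
    simp [fderiv_fun_id]

open Filter Topology in
lemma aux_stokes {E : Type*} [NormedAddCommGroup E] [NormedSpace ℂ E] [CompleteSpace E]
    {V : Set ℂ} (hV : IsOpen V) {F : ℂ → E} (hF : DifferentiableOn ℂ F V)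
    {g : ℂ → ℂ} (hg : ContDiff ℝ 1 g) (hg0 : ∀ z, z ∉ V → g z = 0)
    (hginf : Tendsto g (cocompact ℂ) (𝓝 0))
    {B : ℂ → ℝ} (hB : Integrable B) (hbd : ∀ z ∈ V, ‖fderiv ℝ g z‖ * ‖F z‖ ≤ B z)
    (hB0 : ∀ z, 0 ≤ B z) :
    ∫ z : ℂ, dbar g z • F z = 0 := by
  obtain ⟨Φ, hΦ, hΦ0, hΦ1, C, hC0, hC⟩ := aux_trunc
  let h : ℕ → ℂ → ℂ := fun n z => ((n:ℝ)+1)⁻¹ • Φ (((n:ℝ)+1) • g z)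
  have hn : ∀ n : ℕ, (0:ℝ) < (n:ℝ) + 1 := fun n => by positivity
  have hh : ∀ n, ContDiff ℝ 1 (h n) := fun n =>
    (hΦ.comp (hg.const_smul ((n:ℝ)+1))).const_smul ((n:ℝ)+1)⁻¹
  have hfd : ∀ n z, fderiv ℝ (h n) z = (fderiv ℝ Φ (((n:ℝ)+1) • g z)).comp (fderiv ℝ g z) := by
    intro n z
    have h1 := (hg.differentiable (by norm_num) z).hasFDerivAt.const_smul ((n:ℝ)+1)
    have h2 := (hΦ.differentiable (by norm_num) (((n:ℝ)+1) • g z)).hasFDerivAt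
    have h3 := (h2.comp z h1).const_smul ((n:ℝ)+1)⁻¹
    refine h3.fderiv.trans ?_
    ext v
    simp [(hn n).ne']
  have hsupp : ∀ (n : ℕ) z, ‖g z‖ ≤ ((n:ℝ)+1)⁻¹ → h n z = 0 := by
    intro n z hz
    have : Φ (((n:ℝ)+1) • g z) = 0 := by
      apply hΦ0
      rw [norm_smul, Real.norm_of_nonneg (hn n).le]
      calc _ ≤ ((n:ℝ)+1) * ((n:ℝ)+1)⁻¹ := by gcongr
        _ = 1 := mul_inv_cancel₀ (hn n).ne'
    simp only [h, this, smul_zero]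
  have hts : ∀ n, tsupport (h n) ⊆ {z | ((n:ℝ)+1)⁻¹ ≤ ‖g z‖} := by
    intro n
    apply closure_minimal
    · intro z hz
      by_contra hlt
      simp only [Set.mem_ofPred_eq, not_le] at hlt
      exact hz (hsupp n z hlt.le)
    · exact isClosed_le continuous_const hg.continuous.norm
  have hcs : ∀ n, HasCompactSupport (h n) := by
    intro n
    rw [hasCompactSupport_iff_eventuallyEq, coclosedCompact_eq_cocompact]
    have := hginf.norm
    simp only [norm_zero] at this
    filter_upwards [this.eventually (gt_mem_nhds (inv_pos.mpr (hn n)))] with z hz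
    exact hsupp n z hz.le
  have htsV : ∀ n, tsupport (h n) ⊆ V := by
    intro n z hz
    by_contra hzV
    have := hts n hz
    simp only [Set.mem_ofPred_eq, hg0 z hzV, norm_zero] at this
    linarith [inv_pos.mpr (hn n)]
  have hz : ∀ n, ∫ z : ℂ, dbar (h n) z • F z = 0 := fun n =>
    (aux_compact hV hF (hh n) (hcs n) (htsV n)).2
  have hlim : Tendsto (fun n => ∫ z : ℂ, dbar (h n) z • F z) atTop (𝓝 (∫ z : ℂ, dbar g z • F z)) := by
    apply tendsto_integral_of_dominated_convergence (fun z => C * B z)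
    · exact fun n => (aux_compact hV hF (hh n) (hcs n) (htsV n)).1.1
    · exact hB.const_mul C
    · intro n
      refine Eventually.of_forall fun z => ?_
      by_cases hzV : z ∈ V
      · rw [norm_smul]
        calc ‖dbar (h n) z‖ * ‖F z‖ ≤ (C * ‖fderiv ℝ g z‖) * ‖F z‖ := by
              gcongr
              refine (aux_dbar_norm_le _ _).trans ?_
              rw [hfd]
              refine (ContinuousLinearMap.opNorm_comp_le _ _).trans ?_
              gcongr; exact hC _
          _ = C * (‖fderiv ℝ g z‖ * ‖F z‖) := by ring
          _ ≤ _ := by gcongr; exact hbd z hzV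
      · have e : fderiv ℝ (h n) z = 0 := by
          by_contra hne
          exact hzV (htsV n (support_fderiv_subset ℝ (f := h n) hne))
        simp only [dbar, e]
        simp
        exact mul_nonneg hC0 (hB0 z)
    · filter_upwards [aux_ae_fderiv_zero hg] with z hz
      by_cases hgz : g z = 0
      · have e : ∀ n, dbar (h n) z = dbar g z := by
          intro n; simp [dbar, hfd, hz hgz]
        simp [e]
      · apply tendsto_const_nhds.congr'
        have : Tendsto (fun n : ℕ => ((n:ℝ)+1) * ‖g z‖) atTop atTop :=
          (tendsto_atTop_add_const_right _ _ tendsto_natCast_atTop_atTop).atTop_mul_const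
            (norm_pos_iff.mpr hgz)
        filter_upwards [this.eventually_gt_atTop 2] with n hn2
        have : fderiv ℝ Φ (((n:ℝ)+1) • g z) = ContinuousLinearMap.id ℝ ℂ := by
          have : Φ =ᶠ[𝓝 (((n:ℝ)+1) • g z)] id := by
            have : ∀ᶠ w in 𝓝 (((n:ℝ)+1) • g z), 2 < ‖w‖ := by
              apply continuous_norm.continuousAt.eventually (lt_mem_nhds _)
              change 2 < ‖((n:ℝ)+1) • g z‖
              rwa [norm_smul, Real.norm_of_nonneg (hn n).le]
            filter_upwards [this] with w hw
            exact hΦ1 w hw.le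
          rw [this.fderiv_eq, fderiv_id]
        simp only [dbar, hfd, this, ContinuousLinearMap.id_comp]
  simp only [hz] at hlim
  exact (tendsto_nhds_unique hlim tendsto_const_nhds)
lemma jb_one_le (x : ℝ) : 1 ≤ jbrack x := by
  unfold jbrack; rw [Real.one_le_sqrt]; nlinarith [sq_nonneg x]

lemma jb_pos (x : ℝ) : 0 < jbrack x := lt_of_lt_of_le one_pos (jb_one_le x)

lemma jb_abs_le (x : ℝ) : |x| ≤ jbrack x := by
  unfold jbrack; apply Real.abs_le_sqrt; linarith

lemma jb_continuous : Continuous jbrack := by unfold jbrack; fun_prop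

/-- The open region. -/
def Vset (δ : ℝ) : Set ℂ := {z : ℂ | 0 < |z.im| ∧ |z.im| < δ * jbrack z.re}

lemma Vset_open (δ : ℝ) : IsOpen (Vset δ) := by
  have h0 := jb_continuous
  have h1 : Continuous (fun z : ℂ => |z.im|) := by fun_prop
  have h2 : Continuous (fun z : ℂ => δ * jbrack z.re) := by fun_prop
  exact (isOpen_lt continuous_const h1).inter (isOpen_lt h1 h2)

lemma aux_res_identity {H : Type*} [NormedAddCommGroup H] [InnerProductSpace ℂ H]
    (A : H →ₗ.[ℂ] H) (U : Set ℂ) (Rz : ℂ → H →L[ℂ] H)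
    (hres1 : ∀ z ∈ U, ∀ u : H,
      ∃ h : Rz z u ∈ A.domain, z • Rz z u - A ⟨Rz z u, h⟩ = u)
    (hres2 : ∀ z ∈ U, ∀ x : A.domain, Rz z (z • (x : H) - A x) = (x : H))
    {z w : ℂ} (hz : z ∈ U) (hw : w ∈ U) :
    Rz w - Rz z = (z - w) • ((Rz w) * (Rz z)) := by
  ext u
  obtain ⟨h, hu⟩ := hres1 z hz u
  have h2 := hres2 w hw ⟨Rz z u, h⟩
  simp only at h2
  have h3 : Rz w u = Rz w (w • Rz z u - A ⟨Rz z u, h⟩) + (z - w) • Rz w (Rz z u) := by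
    rw [← map_smul (Rz w), ← map_add (Rz w)]
    congr 1
    conv_lhs => rw [← hu]
    module
  rw [h2] at h3
  simp [h3]

open Filter Topology in
lemma aux_res_diff {H : Type*} [NormedAddCommGroup H] [InnerProductSpace ℂ H] 
    {V : Set ℂ} (hV : IsOpen V) (Rz : ℂ → H →L[ℂ] H)
    (hid : ∀ z ∈ V, ∀ w ∈ V, Rz w - Rz z = (z - w) • ((Rz w) * (Rz z)))
    (hloc : ∀ z ∈ V, ∃ K, ∀ᶠ w in 𝓝 z, ‖Rz w‖ ≤ K) : DifferentiableOn ℂ Rz V := by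
  intro z hz
  apply DifferentiableAt.differentiableWithinAt
  have hcont : ContinuousAt Rz z := by
    obtain ⟨K, hK⟩ := hloc z hz
    rw [ContinuousAt, tendsto_iff_norm_sub_tendsto_zero]
    have hl : Tendsto (fun w => ‖z - w‖ * (K * ‖Rz z‖)) (𝓝 z) (𝓝 0) := by
      have : Continuous (fun w => ‖z - w‖ * (K * ‖Rz z‖)) := by fun_prop
      simpa using this.tendsto z
    refine squeeze_zero' (Eventually.of_forall fun w => norm_nonneg _) ?_ hl
    filter_upwards [hK, hV.mem_nhds hz] with w hw hwV
    rw [hid z hz w hwV, norm_smul]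
    gcongr
    exact (norm_mul_le _ _).trans (by gcongr)
  have : HasDerivAt Rz (-(Rz z * Rz z)) z := by
    rw [hasDerivAt_iff_tendsto_slope]
    have h1 : Tendsto (fun w => -(Rz w * Rz z)) (𝓝[≠] z) (𝓝 (-(Rz z * Rz z))) :=
      ((hcont.tendsto.mul_const _).neg).mono_left nhdsWithin_le_nhds
    refine h1.congr' ?_
    filter_upwards [self_mem_nhdsWithin, nhdsWithin_le_nhds (hV.mem_nhds hz)] with w hw hwV
    have hne : w - z ≠ 0 := sub_ne_zero.mpr hw
    rw [slope_def_module, hid z hz w hwV, smul_smul]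
    rw [show (w - z)⁻¹ * (z - w) = -1 by field_simp; ring]
    simp
  exact this.differentiableAt

lemma aux_res_bound {H : Type*} [NormedAddCommGroup H] [InnerProductSpace ℂ H]
    (R a δ Cst : ℝ) (m : ℕ) (hCst : 0 < Cst)
    (Rz : ℂ → H →L[ℂ] H)
    (hest0 : ∀ z ∈ U0set R a, ‖Rz z‖ ≤ Cst / |z.im| ^ (m + 1))
    (hestInf : ∀ z ∈ UinfSet R δ, ‖Rz z‖ ≤ Cst / |z.im|)
    (δ1 : ℝ) (hδ1 : 0 < δ1)
    (hsmall : ∀ z : ℂ, 0 < |z.im| → |z.im| ≤ δ1 * jbrack z.re → z ∈ Uset R a δ) :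
    ∃ C, 0 ≤ C ∧ ∀ z ∈ Vset δ1, ‖Rz z‖ ≤ C / (jbrack z.re * (|z.im| / jbrack z.re) ^ (m+1)) := by
  refine ⟨Cst * (1 + δ1 ^ m), by positivity, ?_⟩
  rintro z ⟨hy, hyd⟩
  have hj := jb_pos z.re
  have hj1 := jb_one_le z.re
  have hs : |z.im| / jbrack z.re ≤ δ1 := by rw [div_le_iff₀ hj]; exact hyd.le
  rw [le_div_iff₀ (by positivity)]
  rcases hsmall z hy hyd.le with h | h
  · have := hest0 z h
    calc ‖Rz z‖ * (jbrack z.re * (|z.im| / jbrack z.re) ^ (m+1))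
        ≤ Cst / |z.im| ^ (m + 1) * (jbrack z.re * (|z.im| / jbrack z.re) ^ (m+1)) := by gcongr
      _ = Cst * (1 / jbrack z.re ^ m) := by
          rw [div_pow, pow_succ (jbrack z.re)]; field_simp
      _ ≤ Cst * (1 + δ1 ^ m) := by
          gcongr
          have : 1 / jbrack z.re ^ m ≤ 1 := by
            rw [div_le_one (by positivity)]; exact one_le_pow₀ hj1
          have : 0 ≤ δ1 ^ m := by positivity
          linarith
  · have := hestInf z h
    calc ‖Rz z‖ * (jbrack z.re * (|z.im| / jbrack z.re) ^ (m+1))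
        ≤ Cst / |z.im| * (jbrack z.re * (|z.im| / jbrack z.re) ^ (m+1)) := by gcongr
      _ = Cst * (|z.im| / jbrack z.re) ^ m := by
          rw [pow_succ]; field_simp
      _ ≤ Cst * (1 + δ1 ^ m) := by
          gcongr
          have : (|z.im| / jbrack z.re) ^ m ≤ δ1 ^ m := by gcongr
          linarith

open Filter Topology in
lemma aux_res_diffOn {H : Type*} [NormedAddCommGroup H] [InnerProductSpace ℂ H]
    (A : H →ₗ.[ℂ] H)
    (R a δ Cst : ℝ) (m : ℕ) (hCst : 0 < Cst)
    (Rz : ℂ → H →L[ℂ] H)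
    (hres1 : ∀ z ∈ Uset R a δ, ∀ u : H,
      ∃ h : Rz z u ∈ A.domain, z • Rz z u - A ⟨Rz z u, h⟩ = u)
    (hres2 : ∀ z ∈ Uset R a δ, ∀ x : A.domain, Rz z (z • (x : H) - A x) = (x : H))
    (hest0 : ∀ z ∈ U0set R a, ‖Rz z‖ ≤ Cst / |z.im| ^ (m + 1))
    (hestInf : ∀ z ∈ UinfSet R δ, ‖Rz z‖ ≤ Cst / |z.im|)
    (δ1 : ℝ) (hδ1 : 0 < δ1)
    (hsmall : ∀ z : ℂ, 0 < |z.im| → |z.im| ≤ δ1 * jbrack z.re → z ∈ Uset R a δ) :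
    DifferentiableOn ℂ Rz (Vset δ1) := by
  have hU : ∀ z ∈ Vset δ1, z ∈ Uset R a δ := fun z hz => hsmall z hz.1 hz.2.le
  apply aux_res_diff (Vset_open δ1)
  · intro z hz w hw
    exact aux_res_identity A _ Rz hres1 hres2 (hU z hz) (hU w hw)
  · intro z hz
    obtain ⟨C, -, hC⟩ := aux_res_bound R a δ Cst m hCst Rz hest0 hestInf δ1 hδ1 hsmall
    have hj := jb_pos z.re
    have hy := hz.1
    have hca : ContinuousAt (fun z : ℂ => C / (jbrack z.re * (|z.im| / jbrack z.re) ^ (m+1))) z := by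
      have h0 : ContinuousAt (fun z : ℂ => jbrack z.re) z :=
        (jb_continuous.comp Complex.continuous_re).continuousAt
      have h1 : ContinuousAt (fun z : ℂ => |z.im|) z :=
        (continuous_abs.comp Complex.continuous_im).continuousAt
      exact continuousAt_const.div (h0.mul ((h1.div h0 hj.ne').pow _)) (by positivity)
    refine ⟨C / (jbrack z.re * (|z.im| / jbrack z.re) ^ (m+1)) + 1, ?_⟩
    · filter_upwards [hca.eventually (gt_mem_nhds (lt_add_one _)), (Vset_open δ1).mem_nhds hz]
        with w hw hwV
      exact (hC w hwV).trans hw.le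
/-- weighted bound -/
def Bd {F : Type*} [NormedAddCommGroup F] (δ σ : ℝ) (k : ℕ) (h : ℂ → F) : Prop :=
  ∃ C, 0 ≤ C ∧ ∀ z : ℂ, |z.im| ≤ δ * jbrack z.re →
    ‖h z‖ ≤ C * (jbrack z.re ^ σ * (|z.im| / jbrack z.re) ^ k)

section
variable {F : Type*} [NormedAddCommGroup F]

lemma wt_nonneg (z : ℂ) (σ : ℝ) (k : ℕ) : 0 ≤ jbrack z.re ^ σ * (|z.im| / jbrack z.re) ^ k := by
  have := jb_pos z.re
  positivity

lemma Bd.mono {δ σ : ℝ} (hδ : 0 < δ) {k j : ℕ} (hjk : j ≤ k) {h : ℂ → F} (hh : Bd δ σ k h) :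
    Bd δ σ j h := by
  obtain ⟨C, hC0, hC⟩ := hh
  refine ⟨C * δ ^ (k - j), by positivity, fun z hz => (hC z hz).trans ?_⟩
  have hj := jb_pos z.re
  have hs : |z.im| / jbrack z.re ≤ δ := by rw [div_le_iff₀ hj]; exact hz
  obtain ⟨i, rfl⟩ := Nat.exists_eq_add_of_le hjk
  rw [pow_add, Nat.add_sub_cancel_left]
  calc C * (jbrack z.re ^ σ * ((|z.im| / jbrack z.re) ^ j * (|z.im| / jbrack z.re) ^ i))
      ≤ C * (jbrack z.re ^ σ * ((|z.im| / jbrack z.re) ^ j * δ ^ i)) := by gcongr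
    _ = _ := by ring

lemma Bd.add {δ σ : ℝ} {k : ℕ} {h g : ℂ → F} (hh : Bd δ σ k h) (hg : Bd δ σ k g) :
    Bd δ σ k (fun z => h z + g z) := by
  obtain ⟨C, hC0, hC⟩ := hh
  obtain ⟨D, hD0, hD⟩ := hg
  refine ⟨C + D, by positivity, fun z hz => (norm_add_le _ _).trans ?_⟩
  rw [add_mul]; exact add_le_add (hC z hz) (hD z hz)

lemma Bd.neg {δ σ : ℝ} {k : ℕ} {h : ℂ → F} (hh : Bd δ σ k h) :
    Bd δ σ k (fun z => - h z) := by
  obtain ⟨C, hC0, hC⟩ := hh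
  exact ⟨C, hC0, fun z hz => by rw [norm_neg]; exact hC z hz⟩

lemma Bd.zero {δ σ : ℝ} {k : ℕ} : Bd δ σ k (fun _ => (0:F)) :=
  ⟨0, le_rfl, fun z _ => by simp⟩

lemma Bd.smul [NormedSpace ℂ F] {δ σ τ : ℝ} {k l : ℕ} {a : ℂ → ℂ} {h : ℂ → F}
    (ha : Bd δ σ k a) (hh : Bd δ τ l h) : Bd δ (σ + τ) (k + l) (fun z => a z • h z) := by
  obtain ⟨C, hC0, hC⟩ := ha
  obtain ⟨D, hD0, hD⟩ := hh
  refine ⟨C * D, by positivity, fun z hz => ?_⟩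
  have := jb_pos z.re
  rw [norm_smul, Real.rpow_add this, pow_add]
  calc ‖a z‖ * ‖h z‖ ≤ (C * (jbrack z.re ^ σ * (|z.im| / jbrack z.re) ^ k)) *
        (D * (jbrack z.re ^ τ * (|z.im| / jbrack z.re) ^ l)) :=
        mul_le_mul (hC z hz) (hD z hz) (norm_nonneg _) (mul_nonneg hC0 (wt_nonneg _ _ _))
    _ = _ := by ring

lemma Bd.of_zero_near {δ σ c : ℝ} (hc : 0 < c) (k : ℕ) {h : ℂ → F} (hh : Bd δ σ 0 h)
    (h0 : ∀ z : ℂ, |z.im| < c * jbrack z.re → h z = 0) : Bd δ σ k h := by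
  obtain ⟨C, hC0, hC⟩ := hh
  refine ⟨C / c ^ k, by positivity, fun z hz => ?_⟩
  have hj := jb_pos z.re
  by_cases hlt : |z.im| < c * jbrack z.re
  · rw [h0 z hlt, norm_zero]; exact mul_nonneg (by positivity) (wt_nonneg _ _ _)
  · have hs : c ≤ |z.im| / jbrack z.re := by rw [le_div_iff₀ hj]; exact not_lt.mp hlt
    refine (hC z hz).trans ?_
    calc C * (jbrack z.re ^ σ * (|z.im| / jbrack z.re) ^ 0)
        = C / c ^ k * (jbrack z.re ^ σ * c ^ k) := by field_simp
      _ ≤ _ := by gcongr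

lemma Bd.of_le {G : Type*} [NormedAddCommGroup G] {δ σ : ℝ} {k : ℕ} {h : ℂ → F} {g : ℂ → G}
    (hh : Bd δ σ k h) (hle : ∀ z, ‖g z‖ ≤ ‖h z‖) : Bd δ σ k g := by
  obtain ⟨C, hC0, hC⟩ := hh
  exact ⟨C, hC0, fun z hz => (hle z).trans (hC z hz)⟩
end

/-- C^1 functions with weighted bounds on the function and its derivative -/
def Adm (δ σ : ℝ) (k l : ℕ) (h : ℂ → ℂ) : Prop :=
  ContDiff ℝ 1 h ∧ Bd δ σ k h ∧ Bd δ (σ - 1) l (fderiv ℝ h)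

lemma Adm.diff {δ σ : ℝ} {k l : ℕ} {h : ℂ → ℂ} (hh : Adm δ σ k l h) : Differentiable ℝ h :=
  hh.1.differentiable (by norm_num)

lemma Adm.mono {δ σ : ℝ} (hδ : 0 < δ) {k l k' l' : ℕ} {h : ℂ → ℂ} (hh : Adm δ σ k l h)
    (hk : k' ≤ k) (hl : l' ≤ l) : Adm δ σ k' l' h :=
  ⟨hh.1, hh.2.1.mono hδ hk, hh.2.2.mono hδ hl⟩

lemma Adm.add {δ σ : ℝ} {k l : ℕ} {h g : ℂ → ℂ} (hh : Adm δ σ k l h) (hg : Adm δ σ k l g) :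
    Adm δ σ k l (fun z => h z + g z) := by
  refine ⟨hh.1.add hg.1, hh.2.1.add hg.2.1, ?_⟩
  have : fderiv ℝ (fun z => h z + g z) = fun z => fderiv ℝ h z + fderiv ℝ g z := by
    funext z; exact fderiv_fun_add (hh.diff z) (hg.diff z)
  rw [this]; exact hh.2.2.add hg.2.2

lemma Adm.neg {δ σ : ℝ} {k l : ℕ} {h : ℂ → ℂ} (hh : Adm δ σ k l h) :
    Adm δ σ k l (fun z => - h z) := by
  refine ⟨hh.1.neg, hh.2.1.neg, ?_⟩
  have : fderiv ℝ (fun z => - h z) = fun z => - fderiv ℝ h z := by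
    funext z; exact fderiv_fun_neg
  rw [this]; exact hh.2.2.neg

lemma Adm.const {δ : ℝ} (l : ℕ) (c : ℂ) : Adm δ 0 0 l (fun _ => c) := by
  refine ⟨contDiff_const, ⟨‖c‖, norm_nonneg _, fun z _ => by simp⟩, ?_⟩
  have : fderiv ℝ (fun _ : ℂ => c) = fun z => 0 := by funext z; simp
  rw [this]; exact Bd.zero

lemma Adm.zero {δ σ : ℝ} {k l : ℕ} : Adm δ σ k l (fun _ => 0) := by
  refine ⟨contDiff_const, Bd.zero, ?_⟩
  have : fderiv ℝ (fun _ : ℂ => (0:ℂ)) = fun z => 0 := by funext z; simp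
  rw [this]; exact Bd.zero

lemma Adm.sum {δ σ : ℝ} {k l : ℕ} {ι : Type*} (s : Finset ι) {h : ι → ℂ → ℂ}
    (hh : ∀ i ∈ s, Adm δ σ k l (h i)) : Adm δ σ k l (fun z => ∑ i ∈ s, h i z) := by
  classical
  induction s using Finset.induction_on with
  | empty => simpa using Adm.zero
  | insert i s hi ih =>
    simp only [Finset.sum_insert hi]
    exact (hh i (Finset.mem_insert_self _ _)).add
      (ih fun j hj => hh j (Finset.mem_insert_of_mem hj))

lemma Adm.mul {δ σ τ : ℝ} (hδ : 0 < δ) {k l k' l' i j : ℕ} {h g : ℂ → ℂ} (hh : Adm δ σ k l h)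
    (hg : Adm δ τ k' l' g) (hj : j ≤ k + k') (hi1 : i ≤ k + l') (hi2 : i ≤ k' + l) :
    Adm δ (σ + τ) j i (fun z => h z * g z) := by
  refine ⟨hh.1.mul hg.1, ?_, ?_⟩
  · exact (hh.2.1.smul hg.2.1).mono hδ hj
  · have : fderiv ℝ (fun z => h z * g z) = fun z => h z • fderiv ℝ g z + g z • fderiv ℝ h z := by
      funext z; exact fderiv_fun_mul (hh.diff z) (hg.diff z)
    rw [this]
    have h1 := (hh.2.1.smul hg.2.2).mono hδ hi1
    have h2 := (hg.2.1.smul hh.2.2).mono hδ hi2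
    rw [show σ + (τ - 1) = σ + τ - 1 by ring] at h1
    rw [show τ + (σ - 1) = σ + τ - 1 by ring] at h2
    exact h1.add h2

lemma dbar_mul {h g : ℂ → ℂ} {z : ℂ} (hh : DifferentiableAt ℝ h z) (hg : DifferentiableAt ℝ g z) :
    dbar (fun z => h z * g z) z = h z * dbar g z + g z * dbar h z := by
  unfold dbar
  rw [fderiv_fun_mul hh hg]; simp; ring

lemma dbar_add {h g : ℂ → ℂ} {z : ℂ} (hh : DifferentiableAt ℝ h z) (hg : DifferentiableAt ℝ g z) :
    dbar (fun z => h z + g z) z = dbar h z + dbar g z := by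
  unfold dbar
  rw [fderiv_fun_add hh hg]; simp; ring

lemma dbar_sub {h g : ℂ → ℂ} {z : ℂ} (hh : DifferentiableAt ℝ h z) (hg : DifferentiableAt ℝ g z) :
    dbar (fun z => h z - g z) z = dbar h z - dbar g z := by
  unfold dbar
  rw [fderiv_fun_sub hh hg]; simp; ring
lemma adm_F {ρ : ℝ} {f : ℝ → ℂ} (hf : SclassC ρ f) (δ : ℝ) (r : ℕ) :
    Adm δ (ρ - r) 0 0 (fun z : ℂ => iteratedDeriv r f z.re) := by
  have hcd : ContDiff ℝ 1 (iteratedDeriv r f) := by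
    apply ContDiff.iterate_deriv' 1 r (hf.1.of_le _) |> fun h => by
      simpa [iteratedDeriv_eq_iterate] using h
    exact_mod_cast le_top
  have hb : ∀ s : ℕ, ∃ C, 0 ≤ C ∧ ∀ x, ‖iteratedDeriv s f x‖ ≤ C * jbrack x ^ (ρ - (s:ℝ)) := by
    intro s
    obtain ⟨C, hC⟩ := hf.2 s
    refine ⟨|C|, abs_nonneg _, fun x => (hC x).trans ?_⟩
    have := jb_pos x
    gcongr
    exact le_abs_self C
  refine ⟨hcd.comp Complex.reCLM.contDiff, ?_, ?_⟩
  · obtain ⟨C, hC0, hC⟩ := hb r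
    exact ⟨C, hC0, fun z _ => by simpa using hC z.re⟩
  · obtain ⟨C, hC0, hC⟩ := hb (r+1)
    refine ⟨C, hC0, fun z _ => ?_⟩
    have h1 : HasDerivAt (iteratedDeriv r f) (iteratedDeriv (r+1) f z.re) z.re := by
      rw [iteratedDeriv_succ]
      exact (hcd.differentiable (by norm_num) _).hasDerivAt
    have h2 : HasFDerivAt (fun z : ℂ => iteratedDeriv r f z.re) _ z :=
      h1.hasFDerivAt.comp z Complex.reCLM.hasFDerivAt
    rw [h2.fderiv]
    refine (ContinuousLinearMap.opNorm_comp_le _ _).trans ?_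
    have := hC z.re
    rw [Complex.reCLM_norm]
    simp only [ContinuousLinearMap.norm_toSpanSingleton]
    push_cast at this
    rw [show ρ - ((r:ℝ)+1) = ρ - r - 1 by ring] at this
    simpa using this

lemma dbar_F {ρ : ℝ} {f : ℝ → ℂ} (hf : SclassC ρ f) (r : ℕ) (z : ℂ) :
    dbar (fun z : ℂ => iteratedDeriv r f z.re) z = iteratedDeriv (r+1) f z.re / 2 := by
  have hcd : ContDiff ℝ 1 (iteratedDeriv r f) := by
    apply ContDiff.iterate_deriv' 1 r (hf.1.of_le _) |> fun h => by
      simpa [iteratedDeriv_eq_iterate] using h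
    exact_mod_cast le_top
  have h1 : HasDerivAt (iteratedDeriv r f) (iteratedDeriv (r+1) f z.re) z.re := by
    rw [iteratedDeriv_succ]
    exact (hcd.differentiable (by norm_num) _).hasDerivAt
  have h2 : HasFDerivAt (fun z : ℂ => iteratedDeriv r f z.re) _ z :=
    h1.hasFDerivAt.comp z Complex.reCLM.hasFDerivAt
  unfold dbar
  rw [h2.fderiv]
  simp

lemma hasFDerivAt_Y (r : ℕ) (z : ℂ) : HasFDerivAt (fun z : ℂ => (Complex.I * (z.im : ℂ)) ^ r)
    (((r:ℂ) * (Complex.I * (z.im : ℂ)) ^ (r-1)) • (Complex.I • (Complex.ofRealCLM.comp Complex.imCLM))) z := by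
  have h1 : HasFDerivAt (fun z : ℂ => Complex.I * (z.im : ℂ))
      (Complex.I • (Complex.ofRealCLM.comp Complex.imCLM)) z :=
    (Complex.ofRealCLM.comp Complex.imCLM).hasFDerivAt.const_mul Complex.I
  have := h1.pow r
  simpa using this

lemma dbar_Y (r : ℕ) (z : ℂ) : dbar (fun z : ℂ => (Complex.I * (z.im : ℂ)) ^ r) z
    = - ((r:ℂ) * (Complex.I * (z.im : ℂ)) ^ (r-1)) / 2 := by
  unfold dbar
  rw [(hasFDerivAt_Y r z).fderiv]
  simp
  linear_combination ((r:ℂ) * (Complex.I * (z.im : ℂ)) ^ (r-1)) * Complex.I_mul_I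

lemma adm_Y (δ : ℝ) (r : ℕ) :
    Adm δ r r (r-1) (fun z : ℂ => (Complex.I * (z.im : ℂ)) ^ r) := by
  have hp : ∀ (z : ℂ) (r : ℕ), jbrack z.re ^ (r:ℝ) * (|z.im| / jbrack z.re) ^ r = |z.im| ^ r := by
    intro z r
    have := jb_pos z.re
    rw [Real.rpow_natCast, div_pow]; field_simp
  refine ⟨?_, ?_, ?_⟩
  · have : ContDiff ℝ 1 (fun z : ℂ => (z.im : ℂ)) :=
      (Complex.ofRealCLM.comp Complex.imCLM).contDiff
    exact (contDiff_const.mul this).pow r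
  · refine ⟨1, zero_le_one, fun z _ => ?_⟩
    rw [hp]; simp
  · refine ⟨r, by positivity, fun z _ => ?_⟩
    rw [(hasFDerivAt_Y r z).fderiv]
    rcases r with _ | r
    · simp
    · push_cast
      rw [show (r:ℝ) + 1 - 1 = r by ring, hp]
      have hn : ‖Complex.ofRealCLM.comp Complex.imCLM‖ ≤ 1 := by
        refine (ContinuousLinearMap.opNorm_comp_le _ _).trans ?_
        simp
      rw [norm_smul, norm_smul, norm_mul, norm_pow, norm_mul]
      have : ‖((r:ℂ)+1)‖ = (r:ℝ)+1 := by
        rw [← Nat.cast_succ, Complex.norm_natCast]; push_cast; rfl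
      rw [this]
      simp only [Complex.norm_I, one_mul, Complex.norm_real, Real.norm_eq_abs]
      calc ((r:ℝ)+1) * |z.im| ^ r * ‖Complex.ofRealCLM.comp Complex.imCLM‖
          ≤ ((r:ℝ)+1) * |z.im| ^ r * 1 := by gcongr
        _ = _ := by ring

/-- Taylor term -/
def Tt (f : ℝ → ℂ) (r : ℕ) (z : ℂ) : ℂ :=
  iteratedDeriv r f z.re * (Complex.I * (z.im : ℂ)) ^ r / (r.factorial : ℂ)

lemma Tt_eq (f : ℝ → ℂ) (r : ℕ) : Tt f r = fun z => (iteratedDeriv r f z.re * 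
    (Complex.I * (z.im : ℂ)) ^ r) * ((r.factorial : ℂ)⁻¹) := by
  funext z; unfold Tt; rw [div_eq_mul_inv]

lemma adm_T {ρ : ℝ} {f : ℝ → ℂ} (hf : SclassC ρ f) {δ : ℝ} (hδ : 0 < δ) (r : ℕ) :
    Adm δ ρ r (r-1) (Tt f r) := by
  rw [Tt_eq]
  have h1 : Adm δ (ρ - r + r) r (r-1) _ := (adm_F hf δ r).mul hδ (adm_Y δ r) (by omega) (by omega) (by omega)
  have h2 := h1.mul hδ (Adm.const 0 ((r.factorial : ℂ)⁻¹)) (i := r-1) (j := r) (by omega) (by omega) (by omega)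
  rw [show ρ - r + r + 0 = ρ by ring] at h2
  exact h2

lemma dbar_T {ρ : ℝ} {f : ℝ → ℂ} (hf : SclassC ρ f) (r : ℕ) (z : ℂ) :
    dbar (Tt f r) z = (iteratedDeriv (r+1) f z.re * (Complex.I * (z.im : ℂ)) ^ r -
      iteratedDeriv r f z.re * ((r:ℂ) * (Complex.I * (z.im : ℂ)) ^ (r-1))) / (2 * (r.factorial : ℂ)) := by
  rw [Tt_eq]
  have d1 := (adm_F hf 1 r).diff z
  have d2 := (adm_Y 1 r).diff z
  rw [dbar_mul (d1.fun_mul d2) (differentiableAt_const _), dbar_mul d1 d2, dbar_F hf, dbar_Y]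
  have : dbar (fun _ : ℂ => ((r.factorial : ℂ)⁻¹)) z = 0 := by simp [dbar]
  rw [this]
  have : (r.factorial : ℂ) ≠ 0 := by exact_mod_cast r.factorial_ne_zero
  field_simp
  ring

/-- Taylor sum -/
def Pp (f : ℝ → ℂ) (N : ℕ) (z : ℂ) : ℂ := ∑ r ∈ Finset.range (N+1), Tt f r z

lemma adm_P {ρ : ℝ} {f : ℝ → ℂ} (hf : SclassC ρ f) {δ : ℝ} (hδ : 0 < δ) (N : ℕ) :
    Adm δ ρ 0 0 (Pp f N) :=
  Adm.sum _ fun r _ => (adm_T hf hδ r).mono hδ (by omega) (by omega)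

lemma dbar_P {ρ : ℝ} {f : ℝ → ℂ} (hf : SclassC ρ f) (N : ℕ) (z : ℂ) :
    dbar (Pp f N) z = iteratedDeriv (N+1) f z.re * (Complex.I * (z.im : ℂ)) ^ N / (2 * (N.factorial : ℂ)) := by
  induction N with
  | zero =>
    have : Pp f 0 = Tt f 0 := by funext z; simp [Pp]
    rw [this, dbar_T hf]; simp
  | succ N ih =>
    have : Pp f (N+1) = fun z => Pp f N z + Tt f (N+1) z := by
      funext z; unfold Pp; rw [Finset.sum_range_succ]
    rw [this, dbar_add ((adm_P hf one_pos N).diff z) ((adm_T hf one_pos (N+1)).diff z), ih, dbar_T hf]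
    have h1 : (N.factorial : ℂ) ≠ 0 := by exact_mod_cast N.factorial_ne_zero
    have h2 : ((N:ℂ)+1) ≠ 0 := by exact_mod_cast N.succ_ne_zero
    rw [Nat.factorial_succ]
    push_cast
    field_simp
    ring

lemma bd_dbar_P {ρ : ℝ} {f : ℝ → ℂ} (hf : SclassC ρ f) (δ : ℝ) (N : ℕ) :
    Bd δ (ρ - 1) N (dbar (Pp f N)) := by
  have h1 := (adm_F hf δ (N+1)).2.1.smul (adm_Y δ N).2.1
  rw [show ρ - ((N+1:ℕ):ℝ) + N = ρ - 1 by push_cast; ring, Nat.zero_add] at h1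
  refine h1.of_le fun z => ?_
  rw [dbar_P hf, norm_div, smul_eq_mul]
  apply div_le_self (norm_nonneg _)
  have : (1:ℝ) ≤ N.factorial := by exact_mod_cast N.factorial_pos
  simp
  linarith

/-- cutoff -/
def Xx (δ' : ℝ) (χ : ℝ → ℝ) (z : ℂ) : ℂ := (χ (z.im / (δ' * jbrack z.re)) : ℂ)

lemma aaExt_eq (N : ℕ) (δ' : ℝ) (χ : ℝ → ℝ) (f : ℝ → ℂ) :
    aaExt N δ' χ f = fun z => Pp f N z * Xx δ' χ z := rfl

lemma jb_hasDerivAt (x : ℝ) : HasDerivAt jbrack (x / jbrack x) x := by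
  have h : HasDerivAt (fun x : ℝ => 1 + x ^ 2) (2 * x) x := by
    simpa using (hasDerivAt_pow 2 x).const_add 1
  have := h.sqrt (by positivity)
  have e : x / jbrack x = 2 * x / (2 * Real.sqrt (1 + x ^ 2)) := by
    rw [mul_div_mul_left _ _ two_ne_zero]; rfl
  rw [e]; exact this

lemma u_hasFDerivAt {δ' : ℝ} (hδ' : 0 < δ') (z : ℂ) :
    ∃ L : ℂ →L[ℝ] ℝ, HasFDerivAt (fun z : ℂ => z.im / (δ' * jbrack z.re)) L z ∧
      ‖L‖ ≤ δ'⁻¹ * (1 + |z.im| / jbrack z.re) * (jbrack z.re)⁻¹ := by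
  have hj := jb_pos z.re
  have h1 : HasDerivAt (fun x : ℝ => (δ' * jbrack x)⁻¹) _ z.re :=
    (((jb_hasDerivAt z.re).const_mul δ').fun_inv (by positivity))
  have h2 := h1.comp_hasFDerivAt z Complex.reCLM.hasFDerivAt
  have h3 := Complex.imCLM.hasFDerivAt (x := z) |>.mul h2
  refine ⟨_, h3, ?_⟩
  refine (norm_add_le _ _).trans ?_
  rw [norm_smul, norm_smul, norm_smul, Complex.reCLM_norm, Complex.imCLM_norm]
  simp only [Complex.imCLM_apply, Function.comp, Real.norm_eq_abs]
  have hx := jb_abs_le z.re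
  rw [abs_div, abs_neg, abs_mul, abs_div, abs_inv, abs_pow, abs_of_pos (mul_pos hδ' hj),
    abs_of_pos hj, abs_of_pos hδ']
  have : δ' * (|z.re| / jbrack z.re) / (δ' * jbrack z.re) ^ 2 ≤ δ'⁻¹ * (jbrack z.re)⁻¹ * (jbrack z.re)⁻¹ := by
    have : |z.re| / jbrack z.re ≤ 1 := by rw [div_le_one hj]; exact hx
    calc δ' * (|z.re| / jbrack z.re) / (δ' * jbrack z.re) ^ 2 ≤ δ' * 1 / (δ' * jbrack z.re) ^ 2 := by gcongr
      _ = _ := by field_simp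
  calc |z.im| * (δ' * (|z.re| / jbrack z.re) / (δ' * jbrack z.re) ^ 2 * 1) + (δ' * jbrack z.re)⁻¹ * 1
      ≤ |z.im| * (δ'⁻¹ * (jbrack z.re)⁻¹ * (jbrack z.re)⁻¹ * 1) + (δ' * jbrack z.re)⁻¹ * 1 := by gcongr
    _ = _ := by field_simp; ring

lemma jb_contDiff : ContDiff ℝ 1 jbrack := by
  unfold jbrack
  apply ContDiff.sqrt (by fun_prop)
  intro x; positivity

lemma X_one {δ' : ℝ} (hδ' : 0 < δ') {χ : ℝ → ℝ} (hχ : AdmissibleCutoff χ) (z : ℂ)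
    (hz : |z.im| < δ' / 2 * jbrack z.re) : Xx δ' χ z = 1 := by
  have hj := jb_pos z.re
  unfold Xx
  rw [hχ.2.2.1]; · simp
  rw [abs_div, abs_of_pos (mul_pos hδ' hj), div_le_iff₀ (by positivity)]
  linarith

lemma χ_zero {χ : ℝ → ℝ} (hχ : AdmissibleCutoff χ) (s : ℝ) (hs : 1 ≤ |s|) : χ s = 0 := by
  have hcl : IsClosed {s | χ s = 0} := isClosed_eq hχ.1.continuous continuous_const
  have hsub : closure {s : ℝ | 1 < |s|} ⊆ {s | χ s = 0} :=
    closure_minimal (fun s hs => hχ.2.2.2 s hs) hcl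
  apply hsub
  rcases hs.lt_or_eq with h | h
  · exact subset_closure h
  · have hs0 : s ≠ 0 := by rintro rfl; simp at h
    have : Filter.Tendsto (fun n : ℕ => (1 + 1 / ((n:ℝ)+1)) * s) Filter.atTop (nhds ((1 + 0) * s)) :=
      (tendsto_one_div_add_atTop_nhds_zero_nat.const_add 1).mul_const s
    rw [add_zero, one_mul] at this
    refine mem_closure_of_tendsto this (Filter.Eventually.of_forall fun n => ?_)
    change 1 < |(1 + 1 / ((n:ℝ)+1)) * s|
    rw [abs_mul, ← h, mul_one, abs_of_pos (by positivity)]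
    have : 0 < 1 / ((n:ℝ)+1) := by positivity
    linarith

lemma X_zero {δ' : ℝ} (hδ' : 0 < δ') {χ : ℝ → ℝ} (hχ : AdmissibleCutoff χ) (z : ℂ)
    (hz : δ' * jbrack z.re ≤ |z.im|) : Xx δ' χ z = 0 := by
  have hj := jb_pos z.re
  unfold Xx
  rw [χ_zero hχ]; · simp
  rw [abs_div, abs_of_pos (mul_pos hδ' hj), le_div_iff₀ (by positivity)]
  linarith

lemma adm_X {δ δ' : ℝ} (hδ : 0 < δ) (hδ' : 0 < δ') {χ : ℝ → ℝ} (hχ : AdmissibleCutoff χ) (k : ℕ) :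
    Adm δ 0 0 k (Xx δ' χ) := by
  have hχ1 : ContDiff ℝ 1 χ := hχ.1.of_le (by exact_mod_cast le_top)
  refine ⟨?_, ?_, ?_⟩
  · refine Complex.ofRealCLM.contDiff.comp (hχ1.comp ?_)
    refine Complex.imCLM.contDiff.div (contDiff_const.mul (jb_contDiff.comp Complex.reCLM.contDiff)) ?_
    intro z; exact (mul_pos hδ' (jb_pos _)).ne'
  · obtain ⟨C, hC⟩ := hχ.1.continuous.bounded_above_of_compact_support hχ.2.1
    refine ⟨C, (norm_nonneg _).trans (hC 0), fun z _ => ?_⟩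
    simpa [Xx] using hC _
  · refine Bd.of_zero_near (c := δ'/2) (by positivity) k ?_ ?_
    · obtain ⟨C, hC⟩ := (hχ1.continuous_deriv (by norm_num)).bounded_above_of_compact_support hχ.2.1.deriv
      have hC0 : 0 ≤ C := (norm_nonneg _).trans (hC 0)
      refine ⟨C * (δ'⁻¹ * (1 + δ)), by positivity, fun z hz => ?_⟩
      have hj := jb_pos z.re
      obtain ⟨L, hL, hLn⟩ := u_hasFDerivAt hδ' z
      have h1 : HasFDerivAt (Xx δ' χ) _ z := Complex.ofRealCLM.hasFDerivAt.comp z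
        ((hχ1.differentiable (by norm_num) _).hasDerivAt.comp_hasFDerivAt z hL)
      rw [h1.fderiv]
      refine (ContinuousLinearMap.opNorm_comp_le _ _).trans ?_
      rw [Complex.ofRealCLM_norm, one_mul, norm_smul, pow_zero, mul_one, zero_sub, Real.rpow_neg_one, mul_assoc]
      have hs : |z.im| / jbrack z.re ≤ δ := by rw [div_le_iff₀ hj]; exact hz
      refine mul_le_mul (hC _) (hLn.trans ?_) (norm_nonneg _) hC0
      gcongr
    · intro z hz
      have : Xx δ' χ =ᶠ[nhds z] fun _ => 1 := by
        have h1 : Continuous (fun z : ℂ => |z.im|) := by fun_prop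
        have h2 : Continuous (fun z : ℂ => δ' / 2 * jbrack z.re) := by
          have := jb_continuous
          fun_prop
        filter_upwards [(isOpen_lt h1 h2).mem_nhds hz] with w hw
        exact X_one hδ' hχ w hw
      rw [this.fderiv_eq]; simp

lemma bd_dbar_aaExt {ρ : ℝ} {f : ℝ → ℂ} (hf : SclassC ρ f) {δ δ' : ℝ} (hδ : 0 < δ) (hδ' : 0 < δ')
    {χ : ℝ → ℝ} (hχ : AdmissibleCutoff χ) (N k : ℕ) (hk : k ≤ N) :
    Bd δ (ρ - 1) k (dbar (aaExt N δ' χ f)) := by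
  have e : dbar (aaExt N δ' χ f) = fun z => Pp f N z • dbar (Xx δ' χ) z + Xx δ' χ z • dbar (Pp f N) z := by
    funext z
    rw [aaExt_eq, dbar_mul ((adm_P hf hδ N).diff z) ((adm_X hδ hδ' hχ 0).diff z)]
    rfl
  rw [e]
  have h1 := (adm_P hf hδ N).2.1.smul ((adm_X hδ hδ' hχ k).2.2.of_le (aux_dbar_norm_le _))
  have h2 := (adm_X hδ hδ' hχ k).2.1.smul ((bd_dbar_P hf δ N).mono hδ hk)
  rw [Nat.zero_add, show ρ + (0 - 1) = ρ - 1 by ring] at h1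
  rw [Nat.zero_add, zero_add] at h2
  exact h1.add h2

lemma adm_aaExt {ρ : ℝ} {f : ℝ → ℂ} (hf : SclassC ρ f) {δ δ' : ℝ} (hδ : 0 < δ) (hδ' : 0 < δ')
    {χ : ℝ → ℝ} (hχ : AdmissibleCutoff χ) (N : ℕ) : Adm δ ρ 0 0 (aaExt N δ' χ f) := by
  rw [aaExt_eq]
  simpa using (adm_P hf hδ N).mul hδ (adm_X hδ hδ' hχ 0) (i := 0) (j := 0) (by omega) (by omega) (by omega)

lemma adm_Q {ρ : ℝ} {f : ℝ → ℂ} (hf : SclassC ρ f) {δ : ℝ} (hδ : 0 < δ) {M N : ℕ} (h : M ≤ N) :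
    ∃ Q : ℂ → ℂ, Adm δ ρ M M Q ∧ ∀ z, Pp f N z = Pp f M z + Q z := by
  refine ⟨fun z => ∑ r ∈ Finset.Ico (M+1) (N+1), Tt f r z, ?_, ?_⟩
  · refine Adm.sum _ fun r hr => ?_
    rw [Finset.mem_Ico] at hr
    exact (adm_T hf hδ r).mono hδ (by omega) (by omega)
  · intro z
    unfold Pp
    rw [Finset.sum_range_add_sum_Ico _ (by omega)]

lemma adm_diff {ρ : ℝ} {f : ℝ → ℂ} (hf : SclassC ρ f) {δ δ1 δ2 : ℝ} (hδ : 0 < δ) (hδ1 : 0 < δ1)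
    (hδ2 : 0 < δ2) {χ1 χ2 : ℝ → ℝ} (hχ1 : AdmissibleCutoff χ1) (hχ2 : AdmissibleCutoff χ2)
    {M N1 N2 : ℕ} (h1 : M ≤ N1) (h2 : M ≤ N2) :
    Adm δ ρ 0 M (fun z => aaExt N1 δ1 χ1 f z - aaExt N2 δ2 χ2 f z) := by
  obtain ⟨Q1, hQ1, e1⟩ := adm_Q hf hδ h1
  obtain ⟨Q2, hQ2, e2⟩ := adm_Q hf hδ h2
  have hX : Adm δ 0 M M (fun z => Xx δ1 χ1 z + - Xx δ2 χ2 z) := by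
    have h := (adm_X hδ hδ1 hχ1 M).add (adm_X hδ hδ2 hχ2 M).neg
    refine ⟨h.1, Bd.of_zero_near (c := min δ1 δ2 / 2) (by positivity) M h.2.1 ?_, h.2.2⟩
    intro z hz
    have hj := jb_pos z.re
    rw [X_one hδ1 hχ1, X_one hδ2 hχ2]
    · simp
    · refine hz.trans_le ?_
      gcongr
      exact min_le_right _ _
    · refine hz.trans_le ?_
      gcongr
      exact min_le_left _ _
  have t1 := (hQ1.mul hδ (adm_X hδ hδ1 hχ1 M) (i := M) (j := 0) (by omega) (by omega) (by omega))
  have t2 := (hQ2.mul hδ (adm_X hδ hδ2 hχ2 M) (i := M) (j := 0) (by omega) (by omega) (by omega))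
  have t3 := ((adm_P hf hδ M).mul hδ hX (i := M) (j := 0) (by omega) (by omega) (by omega))
  have := (t1.add t2.neg).add t3
  rw [add_zero] at this
  convert this using 1
  funext z
  rw [aaExt_eq, aaExt_eq]
  simp only [e1, e2]
  ring
lemma aux_ae_im : ∀ᵐ z : ℂ, z.im ≠ 0 := by
  have hcd : ContDiff ℝ 1 (fun z : ℂ => (z.im : ℂ)) :=
    (Complex.ofRealCLM.comp Complex.imCLM).contDiff
  filter_upwards [aux_ae_fderiv_zero hcd] with z hz h0
  have h1 := hz (by simp [h0])
  have h2 : HasFDerivAt (fun z : ℂ => (z.im : ℂ)) (Complex.ofRealCLM.comp Complex.imCLM) z :=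
    (Complex.ofRealCLM.comp Complex.imCLM).hasFDerivAt
  rw [h2.fderiv] at h1
  have := congrArg (fun L : ℂ →L[ℝ] ℂ => L Complex.I) h1
  simp at this

lemma wt_le {δ σ : ℝ} (hδ : 0 < δ) (hσ : σ ≤ 0) (z : ℂ) (hz : |z.im| ≤ δ * jbrack z.re) :
    jbrack z.re ^ σ ≤ (2 + δ) ^ (-σ) * (1 + ‖z‖) ^ σ := by
  have hj := jb_pos z.re
  have h1 := jb_one_le z.re
  have h2 := jb_abs_le z.re
  have h3 := Complex.norm_le_abs_re_add_abs_im z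
  have h4 : 1 + ‖z‖ ≤ (2 + δ) * jbrack z.re := by linarith
  have h5 := Real.rpow_le_rpow_of_nonpos (by positivity) h4 hσ
  rw [Real.mul_rpow (by positivity) hj.le] at h5
  calc jbrack z.re ^ σ = (2 + δ) ^ (-σ) * ((2 + δ) ^ σ * jbrack z.re ^ σ) := by
        rw [← mul_assoc, ← Real.rpow_add (by positivity)]; simp
    _ ≤ _ := by gcongr

lemma bd_prod {E F : Type*} [NormedAddCommGroup E] [NormedAddCommGroup F] {δ ρ : ℝ} (hδ : 0 < δ)
    (hρ : ρ < 0) (m : ℕ) {h : ℂ → F} (hh : Bd δ (ρ - 1) (m+1) h) {Rz : ℂ → E} {CR : ℝ} (hCR : 0 ≤ CR)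
    (hR : ∀ z ∈ Vset δ, ‖Rz z‖ ≤ CR / (jbrack z.re * (|z.im| / jbrack z.re) ^ (m+1))) :
    ∃ K, 0 ≤ K ∧ ∀ z ∈ Vset δ, ‖h z‖ * ‖Rz z‖ ≤ K * (1 + ‖z‖) ^ (-(2 - ρ)) := by
  obtain ⟨C, hC0, hC⟩ := hh
  refine ⟨C * CR * (2 + δ) ^ (-(ρ - 2)), by positivity, fun z hz => ?_⟩
  have hj := jb_pos z.re
  have hy := hz.1
  calc ‖h z‖ * ‖Rz z‖ ≤ (C * (jbrack z.re ^ (ρ - 1) * (|z.im| / jbrack z.re) ^ (m+1))) *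
        (CR / (jbrack z.re * (|z.im| / jbrack z.re) ^ (m+1))) :=
        mul_le_mul (hC z hz.2.le) (hR z hz) (norm_nonneg _) (mul_nonneg hC0 (wt_nonneg _ _ _))
    _ = C * CR * (jbrack z.re ^ (ρ - 1) / jbrack z.re) := by field_simp
    _ = C * CR * jbrack z.re ^ (ρ - 2) := by
        rw [← Real.rpow_sub_one hj.ne']; congr 2; ring
    _ ≤ C * CR * ((2 + δ) ^ (-(ρ - 2)) * (1 + ‖z‖) ^ (ρ - 2)) := by
        gcongr
        exact wt_le hδ (by linarith) z hz.2.le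
    _ = _ := by rw [neg_sub]; ring_nf

lemma wt_integrable {ρ : ℝ} (hρ : ρ < 0) (K : ℝ) :
    Integrable (fun z : ℂ => K * (1 + ‖z‖) ^ (-(2 - ρ))) := by
  apply Integrable.const_mul
  apply integrable_one_add_norm
  rw [Complex.finrank_real_complex]; push_cast; linarith

lemma aux_integrable {E : Type*} [NormedAddCommGroup E] [NormedSpace ℂ E]
    {δ ρ : ℝ} (hδ : 0 < δ) (hρ : ρ < 0) (m : ℕ) {Rz : ℂ → E} (hRc : ContinuousOn Rz (Vset δ))
    {CR : ℝ} (hCR : 0 ≤ CR)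
    (hR : ∀ z ∈ Vset δ, ‖Rz z‖ ≤ CR / (jbrack z.re * (|z.im| / jbrack z.re) ^ (m+1)))
    {f : ℝ → ℂ} (hf : SclassC ρ f) {N : ℕ} (hN : m + 1 ≤ N)
    {χ : ℝ → ℝ} (hχ : AdmissibleCutoff χ) :
    Integrable (fun z : ℂ => dbar (aaExt N δ χ f) z • Rz z) := by
  have hcd : ContDiff ℝ 1 (aaExt N δ χ f) := (adm_aaExt hf hδ hδ hχ N).1
  have hae : ∀ᵐ z : ℂ, z ∉ Vset δ → dbar (aaExt N δ χ f) z = 0 := by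
    filter_upwards [aux_ae_im, aux_ae_fderiv_zero hcd] with z h1 h2 h3
    have h4 : δ * jbrack z.re ≤ |z.im| := by
      by_contra hlt
      exact h3 ⟨abs_pos.mpr h1, not_le.mp hlt⟩
    have h5 := h2 (by rw [aaExt_eq]; simp only [X_zero hδ hχ z h4, mul_zero])
    simp [dbar, h5]
  obtain ⟨K, hK0, hK⟩ := bd_prod hδ hρ m (bd_dbar_aaExt hf hδ hδ hχ N (m+1) hN) hCR hR
  refine (wt_integrable hρ K).mono' ?_ ?_
  · have hc : ContinuousOn (fun z : ℂ => dbar (aaExt N δ χ f) z • Rz z) (Vset δ) :=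
      (aux_continuous_dbar hcd).continuousOn.smul hRc
    have hm := (Vset_open δ).measurableSet
    have := (aestronglyMeasurable_indicator_iff hm).mpr (hc.aestronglyMeasurable hm (μ := volume))
    refine this.congr ?_
    filter_upwards [hae] with z hz
    by_cases hzV : z ∈ Vset δ
    · simp [hzV]
    · simp [hzV, hz hzV]
  · filter_upwards [hae] with z hz
    by_cases hzV : z ∈ Vset δ
    · rw [norm_smul]; exact hK z hzV
    · rw [hz hzV]; simp; positivity

lemma aaExt_axis {f : ℝ → ℂ} {δ : ℝ} {χ : ℝ → ℝ} (hχ : AdmissibleCutoff χ) (N : ℕ) (z : ℂ)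
    (hz : z.im = 0) : aaExt N δ χ f z = f z.re := by
  unfold aaExt
  rw [hz, zero_div, hχ.2.2.1 0 (by simp), Finset.sum_range_succ']
  simp

/-- **Smooth functional calculus via almost analytic extensions: convergence and
independence of the choices** (Proposition B.5(1)).

`A` is a closed densely defined operator on `H` whose resolvent `Rz z = (z - A)⁻¹` exists on
`U(R, a, δ)` and satisfies the stated estimates there.  For `f ∈ S^ρ(ℝ)`, `ρ < 0`, the
integral defining `f(A)` converges absolutely in operator norm, and its value does not
depend on the admissible choices of `N ≥ m+1`, `δ'` and `χ`. -/
theorem aaExt_functional_calculus_welldefined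
    {H : Type*} [NormedAddCommGroup H] [InnerProductSpace ℂ H] [CompleteSpace H]
    (A : H →ₗ.[ℂ] H)
    (hAclosed : IsClosed (A.graph : Set (H × H)))
    (hAdense : Dense (A.domain : Set H))
    (R a δ Cst : ℝ) (m : ℕ) (hR : 1 ≤ R) (ha : 0 < a) (hδ : 0 < δ) (hCst : 0 < Cst)
    (Rz : ℂ → H →L[ℂ] H)
    -- on `U(R,a,δ)`, `Rz z` is the resolvent `(z - A)⁻¹`
    (hres1 : ∀ z ∈ Uset R a δ, ∀ u : H,
      ∃ h : Rz z u ∈ A.domain, z • Rz z u - A ⟨Rz z u, h⟩ = u)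
    (hres2 : ∀ z ∈ Uset R a δ, ∀ x : A.domain, Rz z (z • (x : H) - A x) = (x : H))
    -- the resolvent estimates
    (hest0 : ∀ z ∈ U0set R a, ‖Rz z‖ ≤ Cst / |z.im| ^ (m + 1))
    (hestInf : ∀ z ∈ UinfSet R δ, ‖Rz z‖ ≤ Cst / |z.im|)
    (ρ : ℝ) (hρ : ρ < 0) (f : ℝ → ℂ) (hf : SclassC ρ f)
    (N1 N2 : ℕ) (hN1 : m + 1 ≤ N1) (hN2 : m + 1 ≤ N2)
    (δ1 δ2 : ℝ) (hδ1 : 0 < δ1) (hδ2 : 0 < δ2)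
    (hδ1small : ∀ z : ℂ, 0 < |z.im| → |z.im| ≤ δ1 * jbrack z.re → z ∈ Uset R a δ)
    (hδ2small : ∀ z : ℂ, 0 < |z.im| → |z.im| ≤ δ2 * jbrack z.re → z ∈ Uset R a δ)
    (χ1 χ2 : ℝ → ℝ) (hχ1 : AdmissibleCutoff χ1) (hχ2 : AdmissibleCutoff χ2) :
    Integrable (fun z : ℂ => dbar (aaExt N1 δ1 χ1 f) z • Rz z) ∧
    ∫ z : ℂ, dbar (aaExt N1 δ1 χ1 f) z • Rz z
      = ∫ z : ℂ, dbar (aaExt N2 δ2 χ2 f) z • Rz z := by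
  obtain ⟨C1, hC1, hR1⟩ := aux_res_bound R a δ Cst m hCst Rz hest0 hestInf δ1 hδ1 hδ1small
  obtain ⟨C2, hC2, hR2⟩ := aux_res_bound R a δ Cst m hCst Rz hest0 hestInf δ2 hδ2 hδ2small
  have hd1 := aux_res_diffOn A R a δ Cst m hCst Rz hres1 hres2 hest0 hestInf δ1 hδ1 hδ1small
  have hd2 := aux_res_diffOn A R a δ Cst m hCst Rz hres1 hres2 hest0 hestInf δ2 hδ2 hδ2small
  have i1 := aux_integrable hδ1 hρ m hd1.continuousOn hC1 hR1 hf hN1 hχ1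
  have i2 := aux_integrable hδ2 hρ m hd2.continuousOn hC2 hR2 hf hN2 hχ2
  refine ⟨i1, ?_⟩
  -- the larger of the two regions
  obtain ⟨δm, hδm, hle1, hle2, hsmall⟩ : ∃ δm : ℝ, 0 < δm ∧ δ1 ≤ δm ∧ δ2 ≤ δm ∧
      ∀ z : ℂ, 0 < |z.im| → |z.im| ≤ δm * jbrack z.re → z ∈ Uset R a δ := by
    rcases le_total δ1 δ2 with h | h
    · exact ⟨δ2, hδ2, h, le_rfl, hδ2small⟩
    · exact ⟨δ1, hδ1, le_rfl, h, hδ1small⟩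
  obtain ⟨C3, hC3, hR3⟩ := aux_res_bound R a δ Cst m hCst Rz hest0 hestInf δm hδm hsmall
  have hd3 := aux_res_diffOn A R a δ Cst m hCst Rz hres1 hres2 hest0 hestInf δm hδm hsmall
  have hadm := adm_diff hf hδm hδ1 hδ2 hχ1 hχ2 hN1 hN2
  obtain ⟨K, hK0, hK⟩ := bd_prod hδm hρ m hadm.2.2 hC3 hR3
  have hz0 : ∀ z, z ∉ Vset δm → aaExt N1 δ1 χ1 f z - aaExt N2 δ2 χ2 f z = 0 := by
    intro z hz
    by_cases h0 : z.im = 0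
    · rw [aaExt_axis hχ1 N1 z h0, aaExt_axis hχ2 N2 z h0, sub_self]
    · have hj := jb_pos z.re
      have h4 : δm * jbrack z.re ≤ |z.im| := by
        by_contra hlt
        exact hz ⟨abs_pos.mpr h0, not_le.mp hlt⟩
      have h5 : δ1 * jbrack z.re ≤ |z.im| := le_trans (by gcongr) h4
      have h6 : δ2 * jbrack z.re ≤ |z.im| := le_trans (by gcongr) h4
      rw [aaExt_eq, aaExt_eq]
      simp only [X_zero hδ1 hχ1 z h5, X_zero hδ2 hχ2 z h6, mul_zero, sub_self]
  have hinf : Filter.Tendsto (fun z => aaExt N1 δ1 χ1 f z - aaExt N2 δ2 χ2 f z)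
      (Filter.cocompact ℂ) (nhds 0) := by
    obtain ⟨C, hC0, hC⟩ := hadm.2.1
    have hlim : Filter.Tendsto (fun z : ℂ => C * ((2 + δm) ^ (-ρ) * (1 + ‖z‖) ^ ρ))
        (Filter.cocompact ℂ) (nhds 0) := by
      have h1 : Filter.Tendsto (fun z : ℂ => 1 + ‖z‖) (Filter.cocompact ℂ) Filter.atTop :=
        Filter.tendsto_atTop_add_const_left _ _ (tendsto_norm_cocompact_atTop)
      have h2 := (tendsto_rpow_neg_atTop (y := -ρ) (by linarith)).comp h1
      have h3 := (h2.const_mul ((2 + δm) ^ (-ρ))).const_mul C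
      simpa [Function.comp_def] using h3
    refine squeeze_zero_norm (fun z => ?_) hlim
    by_cases hz : z ∈ Vset δm
    · refine (hC z hz.2.le).trans ?_
      rw [pow_zero, mul_one]
      gcongr
      exact wt_le hδm hρ.le z hz.2.le
    · rw [hz0 z hz, norm_zero]
      positivity
  have hst := aux_stokes (Vset_open δm) hd3 hadm.1 hz0 hinf (wt_integrable hρ K) hK
    (fun z => by positivity)
  have e : ∀ z, dbar (fun z => aaExt N1 δ1 χ1 f z - aaExt N2 δ2 χ2 f z) z • Rz z =
      dbar (aaExt N1 δ1 χ1 f) z • Rz z - dbar (aaExt N2 δ2 χ2 f) z • Rz z := by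
    intro z
    rw [dbar_sub ((adm_aaExt hf hδm hδ1 hχ1 N1).diff z) ((adm_aaExt hf hδm hδ2 hχ2 N2).diff z),
      sub_smul]
  simp only [e] at hst
  rw [integral_sub i1 i2] at hst
  exact sub_eq_zero.mp hst


end
end

section
/- Selfadjoint operators on Pontryagin spaces are definitizable with an even-degree definitizing polynomial (Theorem B.2). Let H be a complex Hilbert space and M a bounded, invertible, selfadjoint operator on H whose negative spectral subspace is finite-dimensional; concretely, there exist a finite-dimensional subspace F ⊆ H invariant under M and a constant c > 0 such that ⟨u, Mu⟩ ≤ −c‖u‖² for all u ∈ F and ⟨u, Mu⟩ ≥ c‖u‖² for all u in the Hilbert orthogonal complement of F (so that (H, [u,v] := ⟨u, Mv⟩) is a Pontryagin space). Let A be a densely defined operator on H which is selfadjoint for the Krein form, i.e. A = M^{−1} A* M as unbounded operators, where A* is the Hilbert adjoint. Then A is definitizable with a definitizing polynomial of even degree: the resolvent set of A is nonempty, and there exists a nonzero real polynomial p of even degree such that ⟨u, M p(A) u⟩ ≥ 0 for all u in the domain of A^{deg p}. -/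
open scoped ComplexInnerProductSpace


lemma eig_mod {V : Type*} [AddCommGroup V] [Module ℂ V] [FiniteDimensional ℂ V]
    (B : Module.End ℂ V) (R W : Submodule ℂ V) (hR : ∀ x ∈ R, B x ∈ R) (hW : ∀ x ∈ W, B x ∈ W)
    (h : ¬ W ≤ R) : ∃ (l : ℂ) (e : V), e ∈ W ∧ e ∉ R ∧ B e - l • e ∈ R := by
  obtain ⟨w, hwW, hwR⟩ := Set.not_subset.1 h
  let Bq : Module.End ℂ (V ⧸ R) := R.mapQ R B hR
  let Wq : Submodule ℂ (V ⧸ R) := W.map R.mkQ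
  have hWq : ∀ x ∈ Wq, Bq x ∈ Wq := by
    rintro _ ⟨x, hx, rfl⟩
    exact ⟨B x, hW x hx, rfl⟩
  have hnt : Nontrivial Wq := by
    refine ⟨⟨⟨R.mkQ w, w, hwW, rfl⟩, 0, ?_⟩⟩
    intro h0
    have : R.mkQ w = 0 := congrArg Subtype.val h0
    exact hwR (by simpa using this)
  obtain ⟨l, hl⟩ := Module.End.exists_eigenvalue (Bq.restrict hWq)
  obtain ⟨⟨e', he'⟩, he⟩ := hl.exists_hasEigenvector
  obtain ⟨e, heW, rfl⟩ := he'
  refine ⟨l, e, heW, ?_, ?_⟩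
  · intro hr
    apply he.2
    ext
    simpa using hr
  · have h1 := congrArg Subtype.val he.apply_eq_smul
    have h2 : R.mkQ (B e) = l • R.mkQ e := h1
    rw [← map_smul] at h2
    exact (Submodule.Quotient.eq R).1 h2

lemma aeval_mem_inv {V : Type*} [AddCommGroup V] [Module ℂ V]
    (B : Module.End ℂ V) (W : Submodule ℂ V) (hW : ∀ x ∈ W, B x ∈ W) (q : Polynomial ℂ) :
    ∀ x ∈ W, Polynomial.aeval B q x ∈ W := by
  induction q using Polynomial.induction_on' with
  | add p q hp hq => intro x hx; simpa using W.add_mem (hp x hx) (hq x hx)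
  | monomial n a =>
    intro x hx
    have : ∀ n, (B ^ n) x ∈ W := by
      intro n
      induction n with
      | zero => simpa using hx
      | succ n ih => rw [pow_succ']; exact hW _ ih
    simpa [Polynomial.aeval_monomial, Algebra.algebraMap_eq_smul_one] using W.smul_mem a (this n)

lemma aeval_eig_mod {V : Type*} [AddCommGroup V] [Module ℂ V]
    (B : Module.End ℂ V) (R : Submodule ℂ V) (hR : ∀ x ∈ R, B x ∈ R) (l : ℂ) (e : V)
    (he : B e - l • e ∈ R) (q : Polynomial ℂ) :
    Polynomial.aeval B q e - q.eval l • e ∈ R := by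
  obtain ⟨s, hs⟩ := Polynomial.X_sub_C_dvd_sub_C_eval (a := l) (p := q)
  have h1 : q = s * (Polynomial.X - Polynomial.C l) + Polynomial.C (q.eval l) := by
    rw [mul_comm, ← hs]; ring
  have h2 : Polynomial.aeval B q e - q.eval l • e = Polynomial.aeval B s (B e - l • e) := by
    conv_lhs => rw [h1]
    simp [Algebra.algebraMap_eq_smul_one]
  rw [h2]
  exact aeval_mem_inv B R hR s _ he

lemma fd_pontryagin {V : Type*} [AddCommGroup V] [Module ℂ V] [FiniteDimensional ℂ V]
    (G : V →ₗ⋆[ℂ] V →ₗ[ℂ] ℂ) (hG : ∀ u v, star (G u v) = G v u)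
    (B : Module.End ℂ V) (hB : ∀ u v, G (B u) v = G u (B v)) :
    ∀ (n k : ℕ) (W : Submodule ℂ V), Module.finrank ℂ W < n → (∀ x ∈ W, B x ∈ W) →
      (∀ N : Submodule ℂ V, N ≤ W → (∀ x ∈ N, (G x x).re ≤ 0) →
        (∀ x ∈ N, (∀ y ∈ W, G y x = 0) → x = 0) → Module.finrank ℂ N ≤ k) →
      ∃ q : Polynomial ℂ, q ≠ 0 ∧ q.natDegree ≤ k ∧
        ∀ u ∈ W, 0 ≤ (G (Polynomial.aeval B q u) (Polynomial.aeval B q u)).re := by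
  intro n
  induction n with
  | zero => intro k W h; omega
  | succ n ih =>
  intro k W hn hW hk
  let R : Submodule ℂ V :=
    { carrier := {x | x ∈ W ∧ ∀ y ∈ W, G y x = 0}
      add_mem' := by
        rintro a b ⟨ha, ha'⟩ ⟨hb, hb'⟩
        exact ⟨W.add_mem ha hb, fun y hy => by simp [ha' y hy, hb' y hy]⟩
      zero_mem' := ⟨W.zero_mem, fun y _ => by simp⟩
      smul_mem' := by
        rintro a b ⟨hb, hb'⟩
        exact ⟨W.smul_mem a hb, fun y hy => by simp [hb' y hy]⟩ }
  have hRB : ∀ x ∈ R, B x ∈ R := by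
    rintro x ⟨hx, hx'⟩
    exact ⟨hW x hx, fun y hy => by rw [← hB]; exact hx' _ (hW y hy)⟩
  have hR1 : ∀ x ∈ R, ∀ y ∈ W, G y x = 0 := fun x hx => hx.2
  have hR2 : ∀ x ∈ R, ∀ y ∈ W, G x y = 0 := fun x hx y hy => by
    rw [← hG, hx.2 y hy]; simp
  by_cases hWR : W ≤ R
  · refine ⟨1, one_ne_zero, by simp, fun u hu => ?_⟩
    simp [hR1 u (hWR hu) u hu]
  obtain ⟨l, e, heW, heR, hel⟩ := eig_mod B R W hRB hW hWR
  let W' : Submodule ℂ V := W ⊓ LinearMap.ker (G e)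
  have hW'W : W' ≤ W := inf_le_left
  have hW'e : ∀ x ∈ W', G e x = 0 := fun x hx => by simpa using hx.2
  have hW'e2 : ∀ x ∈ W', G x e = 0 := fun x hx => by
    rw [← hG, hW'e x hx]; simp
  have hmem : ∀ x ∈ W, G e x = 0 → x ∈ W' := fun x hx h => ⟨hx, by simpa using h⟩
  have hlt : W' < W := by
    refine lt_of_le_of_ne hW'W fun heq => heR ⟨heW, fun y hy => ?_⟩
    exact hW'e2 y (heq ▸ hy)
  have hn' : Module.finrank ℂ W' < n := by
    have := Submodule.finrank_lt_finrank_of_lt hlt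
    omega
  have hGB : ∀ u ∈ W, G e (B u) = star l * G e u := by
    intro u hu
    have h1 := hR2 _ hel u hu
    rw [← hB]
    simp only [map_sub, map_smulₛₗ, LinearMap.sub_apply, LinearMap.smul_apply] at h1
    simpa [sub_eq_zero] using h1
  have hW'B : ∀ x ∈ W', B x ∈ W' := by
    intro x hx
    exact hmem _ (hW x hx.1) (by rw [hGB x hx.1, hW'e x hx]; simp)
  have hee : ((G e e).re : ℂ) = G e e := Complex.conj_eq_iff_re.1 (hG e e)
  by_cases hg : 0 < (G e e).re
  · obtain ⟨q, hq0, hqk, hq⟩ := ih k W' hn' hW'B (by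
      intro N hN hN1 hN2
      refine hk N (hN.trans hW'W) hN1 fun x hx hx2 => hN2 x hx fun y hy => hx2 y (hW'W hy))
    refine ⟨q, hq0, hqk, fun u hu => ?_⟩
    have hg0 : G e e ≠ 0 := by intro h0; rw [h0] at hg; simp at hg
    set a := G e u / G e e with ha
    set w := u - a • e with hw
    have hwW' : w ∈ W' := by
      refine hmem _ (W.sub_mem hu (W.smul_mem a heW)) ?_
      simp [hw, ha, hg0]
    have hw2 := aeval_mem_inv B W' hW'B q w hwW'
    have hr := aeval_eig_mod B R hRB l e hel q
    set r := Polynomial.aeval B q e - q.eval l • e with hrdef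
    set w2 := Polynomial.aeval B q w with hw2def
    have hsum : Polynomial.aeval B q u = w2 + (a * q.eval l) • e + a • r := by
      have hu' : u = w + a • e := by simp [hw]
      conv_lhs => rw [hu']
      rw [map_add, map_smul, hrdef, smul_sub, mul_smul]
      abel
    have e1 := hW'e _ hw2
    have e2 := hW'e2 _ hw2
    have e3 := hR1 _ hr _ (hW'W hw2)
    have e4 := hR2 _ hr _ (hW'W hw2)
    have e5 := hR1 _ hr _ heW
    have e6 := hR2 _ hr _ heW
    have e7 := hR2 _ hr _ hr.1
    have key : G (Polynomial.aeval B q u) (Polynomial.aeval B q u)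
        = G w2 w2 + ((‖a * q.eval l‖ ^ 2 * (G e e).re : ℝ) : ℂ) := by
      rw [hsum]
      push_cast
      rw [hee, ← Complex.mul_conj']
      simp only [map_add, map_smulₛₗ, LinearMap.add_apply, LinearMap.smul_apply, e1, e2, e3, e4, e5,
        e6, e7, smul_eq_mul, RingHom.id_apply]
      ring
    rw [key, Complex.add_re, Complex.ofReal_re]
    have := hq w hwW'
    positivity
  · push Not at hg
    have step : ∀ N : Submodule ℂ V, N ≤ W' → (∀ x ∈ N, (G x x).re ≤ 0) →
        (∀ x ∈ N, (∀ y ∈ W', G y x = 0) → x = 0) → Module.finrank ℂ N + 1 ≤ k := by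
      intro N hN hN1 hN2
      have hrad : ∀ x ∈ N, ∀ a : ℂ, x + a • e ∈ R → x = 0 ∧ a = 0 := by
        intro x hx a hxa
        have hae : a * G e e = 0 := by
          have := hR1 _ hxa e heW
          simpa [hW'e x (hN hx)] using this
        have hx0 : x = 0 := by
          refine hN2 x hx fun y hy => ?_
          have := hR1 _ hxa y (hW'W hy)
          simpa [hW'e2 y hy] using this
        refine ⟨hx0, ?_⟩
        by_contra ha
        apply heR
        have := R.smul_mem a⁻¹ hxa
        simpa [hx0, smul_smul, ha] using this
      have heN : e ∉ N := by
        intro h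
        have := (hrad e h (-1) (by simp)).2
        norm_num at this
      have hfin := hk (N ⊔ Submodule.span ℂ {e}) (sup_le (hN.trans hW'W) (by simpa using heW)) (by
        intro x hx
        obtain ⟨y, hy, z, hz, rfl⟩ := Submodule.mem_sup.1 hx
        obtain ⟨a, rfl⟩ := Submodule.mem_span_singleton.1 hz
        have : G (y + a • e) (y + a • e) = G y y + ((‖a‖ ^ 2 * (G e e).re : ℝ) : ℂ) := by
          push_cast
          rw [hee, ← Complex.mul_conj']
          simp only [map_add, map_smulₛₗ, LinearMap.add_apply, LinearMap.smul_apply,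
            hW'e y (hN hy), hW'e2 y (hN hy), smul_eq_mul, RingHom.id_apply]
          ring
        rw [this, Complex.add_re, Complex.ofReal_re]
        have h1 := hN1 y hy
        have h2 := mul_nonpos_of_nonneg_of_nonpos (sq_nonneg ‖a‖) hg
        linarith) (by
        intro x hx hx2
        have hxW : x ∈ W := (sup_le (hN.trans hW'W) (by simpa using heW) :
          N ⊔ Submodule.span ℂ {e} ≤ W) hx
        obtain ⟨y, hy, z, hz, rfl⟩ := Submodule.mem_sup.1 hx
        obtain ⟨a, rfl⟩ := Submodule.mem_span_singleton.1 hz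
        obtain ⟨h1, h2⟩ := hrad y hy a ⟨hxW, hx2⟩
        simp [h1, h2])
      have hltN : N < N ⊔ Submodule.span ℂ {e} := by
        refine lt_of_le_of_ne le_sup_left fun h => heN ?_
        rw [h]
        exact (le_sup_right : _ ≤ N ⊔ Submodule.span ℂ {e}) (Submodule.mem_span_singleton_self e)
      have := Submodule.finrank_lt_finrank_of_lt hltN
      omega
    have hk1 : 1 ≤ k := by
      have := step ⊥ bot_le (by intro x hx; simp [(Submodule.mem_bot ℂ).1 hx])
        (by intro x hx _; exact (Submodule.mem_bot ℂ).1 hx)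
      omega
    obtain ⟨q, hq0, hqk, hq⟩ := ih (k - 1) W' hn' hW'B (by
      intro N hN hN1 hN2
      have := step N hN hN1 hN2
      omega)
    refine ⟨q * (Polynomial.X - Polynomial.C (star l)),
      mul_ne_zero hq0 (Polynomial.X_sub_C_ne_zero _), ?_, fun u hu => ?_⟩
    · rw [Polynomial.natDegree_mul hq0 (Polynomial.X_sub_C_ne_zero _), Polynomial.natDegree_X_sub_C]
      omega
    · have : Polynomial.aeval B (q * (Polynomial.X - Polynomial.C (star l))) u
          = Polynomial.aeval B q (B u - star l • u) := by
        simp [Algebra.algebraMap_eq_smul_one]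
      rw [this]
      refine hq _ (hmem _ (W.sub_mem (hW u hu) (W.smul_mem _ hu)) ?_)
      simp [hGB u hu]

lemma approx_incl {H : Type*} [NormedAddCommGroup H] [InnerProductSpace ℂ H]
    (F : Submodule ℂ H) [FiniteDimensional ℂ F] (D : Submodule ℂ H) (hD : Dense (D : Set H))
    (ε : ℝ) (hε : 0 < ε) : ∃ T : F →ₗ[ℂ] D, ∀ x : F, ‖(T x : H) - x‖ ≤ ε * ‖x‖ := by
  let b := stdOrthonormalBasis ℂ F
  set n := Module.finrank ℂ F with hn
  have hε' : 0 < ε / (n + 1) := by positivity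
  have hex : ∀ i, ∃ f : D, ‖(f : H) - b i‖ < ε / (n + 1) := by
    intro i
    obtain ⟨y, hy, hd⟩ := Metric.dense_iff.1 hD (b i : H) _ hε'
    exact ⟨⟨y, hd⟩, by simpa [dist_eq_norm] using hy⟩
  choose f hf using hex
  refine ⟨b.toBasis.constr ℂ f, fun x => ?_⟩
  have h1 : ((b.toBasis.constr ℂ f x : D) : H) = ∑ i, (inner ℂ (b i) x) • (f i : H) := by
    rw [Module.Basis.constr_apply_fintype]
    simp [b.repr_apply_apply]
  have h2 : (x : H) = ∑ i, (inner ℂ (b i) x) • (b i : H) := by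
    conv_lhs => rw [← b.sum_repr' x]
    simp
  have h3 : ((b.toBasis.constr ℂ f x : D) : H) - x
      = ∑ i, (inner ℂ (b i) x) • ((f i : H) - b i) := by
    rw [h1]
    conv_lhs => rw [h2]
    simp [smul_sub, Finset.sum_sub_distrib]
  rw [h3]
  calc _ ≤ ∑ i : Fin n, ‖x‖ * (ε / (n + 1)) := by
        refine norm_sum_le_of_le _ fun i _ => ?_
        rw [norm_smul]
        refine mul_le_mul ?_ (hf i).le (norm_nonneg _) (norm_nonneg _)
        have := norm_inner_le_norm (𝕜 := ℂ) (b i) x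
        simpa using this
    _ = (n / (n + 1)) * (ε * ‖x‖) := by simp; ring
    _ ≤ 1 * (ε * ‖x‖) := by
        refine mul_le_mul_of_nonneg_right ?_ (by positivity)
        rw [div_le_one (by positivity)]; linarith
    _ = _ := one_mul _

lemma coercive_J {H : Type*} [NormedAddCommGroup H] [InnerProductSpace ℂ H] [CompleteSpace H]
    (M : H →L[ℂ] H) (hM : ∀ u v, ⟪M u, v⟫ = ⟪u, M v⟫)
    (F : Submodule ℂ H) [FiniteDimensional ℂ F]
    (hMF : ∀ u ∈ F, M u ∈ F)
    (c : ℝ) 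
    (hneg : ∀ u ∈ F, (⟪u, M u⟫).re ≤ -c * ‖u‖ ^ 2)
    (hpos : ∀ u ∈ Fᗮ, c * ‖u‖ ^ 2 ≤ (⟪u, M u⟫).re) (u : H) :
    c * ‖u‖ ^ 2 ≤ (⟪u - (2 : ℂ) • (F.orthogonalProjectionOnto u : H), M u⟫).re := by
  set a : H := (F.orthogonalProjectionOnto u : H) with ha
  have haF : a ∈ F := (F.orthogonalProjectionOnto u).2
  set b : H := u - a with hb
  have hbF : b ∈ Fᗮ := F.sub_starProjection_mem_orthogonal u
  have hu : u = a + b := by simp [hb]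
  have h1 : ⟪a, M b⟫ = 0 := by
    rw [← hM]; exact hbF _ (hMF a haF)
  have h2 : ⟪b, M a⟫ = 0 := Submodule.inner_left_of_mem_orthogonal (hMF a haF) hbF
  have h3 : ⟪a, b⟫ = 0 := hbF _ haF
  have h4 : ‖u‖ ^ 2 = ‖a‖ ^ 2 + ‖b‖ ^ 2 := by
    have := norm_add_sq_eq_norm_sq_add_norm_sq_of_inner_eq_zero a b h3
    rw [hu]; nlinarith
  have h5 : ⟪u - (2 : ℂ) • a, M u⟫ = ⟪b, M b⟫ - ⟪a, M a⟫ := by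
    have : u - (2 : ℂ) • a = b - a := by rw [hb, two_smul]; abel
    rw [this, hu, map_add, inner_sub_left, inner_add_right, inner_add_right, h1, h2]
    ring
  rw [h5, h4, Complex.sub_re]
  have := hneg a haF
  have := hpos b hbF
  linarith

/-- approximate fundamental symmetry with finite rank part in the domain -/
lemma exists_P {H : Type*} [NormedAddCommGroup H] [InnerProductSpace ℂ H] [CompleteSpace H]
    (M : H →L[ℂ] H) (hM : ∀ u v, ⟪M u, v⟫ = ⟪u, M v⟫)
    (F : Submodule ℂ H) [FiniteDimensional ℂ F]
    (hMF : ∀ u ∈ F, M u ∈ F)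
    (c : ℝ) (hc : 0 < c)
    (hneg : ∀ u ∈ F, (⟪u, M u⟫).re ≤ -c * ‖u‖ ^ 2)
    (hpos : ∀ u ∈ Fᗮ, c * ‖u‖ ^ 2 ≤ (⟪u, M u⟫).re)
    (A : H →ₗ.[ℂ] H) (hdense : Dense (A.domain : Set H)) :
    ∃ (P : H →ₗ[ℂ] A.domain) (C δ : ℝ), 0 ≤ C ∧ 0 < δ ∧ FiniteDimensional ℂ (LinearMap.range P) ∧
      (∀ u, ‖(P u : H)‖ ≤ C * ‖u‖) ∧ (∀ u, ‖A (P u)‖ ≤ C * ‖u‖) ∧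
      ∀ u, δ * ‖u‖ ^ 2 ≤ (⟪u - (2 : ℂ) • (P u : H), M u⟫).re := by
  set ε : ℝ := c / (4 * (‖M‖ + 1)) with hεdef
  have hε : 0 < ε := by positivity
  obtain ⟨T, hT⟩ := approx_incl F A.domain hdense ε hε
  let Q : H →ₗ[ℂ] F := (F.orthogonalProjectionOnto : H →L[ℂ] F)
  have hQ : ∀ u, ‖Q u‖ ≤ ‖u‖ := fun u => F.norm_orthogonalProjectionOnto_apply_le u
  let T1 : F →L[ℂ] H := LinearMap.toContinuousLinearMap (A.domain.subtype ∘ₗ T)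
  let T2 : F →L[ℂ] H := LinearMap.toContinuousLinearMap (A.toFun ∘ₗ T)
  refine ⟨T ∘ₗ Q, max ‖T1‖ ‖T2‖, c / 2, by positivity, by positivity, ?_, ?_, ?_, ?_⟩
  · have : LinearMap.range (T ∘ₗ Q) ≤ LinearMap.range T := LinearMap.range_comp_le_range Q T
    exact Submodule.finiteDimensional_of_le this
  · intro u
    calc ‖T1 (Q u)‖ ≤ ‖T1‖ * ‖Q u‖ := T1.le_opNorm _
      _ ≤ _ := mul_le_mul (le_max_left _ _) (hQ u) (norm_nonneg _) (by positivity)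
  · intro u
    calc ‖T2 (Q u)‖ ≤ ‖T2‖ * ‖Q u‖ := T2.le_opNorm _
      _ ≤ _ := mul_le_mul (le_max_right _ _) (hQ u) (norm_nonneg _) (by positivity)
  · intro u
    have h1 := coercive_J M hM F hMF c hneg hpos u
    have h2 : u - (2 : ℂ) • (((T ∘ₗ Q) u : A.domain) : H) =
        (u - (2 : ℂ) • (Q u : H)) - (2 : ℂ) • ((T (Q u) : H) - Q u) := by
      rw [LinearMap.comp_apply, smul_sub]; abel
    rw [h2, inner_sub_left, Complex.sub_re]
    have h3 : ‖⟪(2 : ℂ) • ((T (Q u) : H) - Q u), M u⟫‖ ≤ (2 * (ε * ‖u‖)) * (‖M‖ * ‖u‖) := by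
      refine (norm_inner_le_norm _ _).trans ?_
      refine mul_le_mul ?_ (M.le_opNorm u) (norm_nonneg _) (by positivity)
      rw [norm_smul]
      have := (hT (Q u)).trans (mul_le_mul_of_nonneg_left (hQ u) hε.le)
      simpa using this
    have h4 := (Complex.re_le_norm _).trans h3
    have h5 : ε * (‖M‖ + 1) = c / 4 := by rw [hεdef]; field_simp
    have h6 : ε * ‖M‖ ≤ c / 4 := by nlinarith
    have h7 : (2 * (ε * ‖u‖)) * (‖M‖ * ‖u‖) ≤ c / 2 * ‖u‖ ^ 2 := by
      have := mul_le_mul_of_nonneg_right h6 (sq_nonneg ‖u‖)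
      nlinarith
    have h1' : c * ‖u‖ ^ 2 ≤ (⟪u - (2 : ℂ) • (Q u : H), M u⟫).re := h1
    linarith

lemma lower_bound {H : Type*} [NormedAddCommGroup H] [InnerProductSpace ℂ H] [CompleteSpace H]
    (M : H →L[ℂ] H) (hM : ∀ u v, ⟪M u, v⟫ = ⟪u, M v⟫)
    (A : H →ₗ.[ℂ] H)
    (hsym : ∀ x y : A.domain, ⟪A x, M y⟫ = ⟪(x : H), M (A y)⟫)
    (P : H →ₗ[ℂ] A.domain) (C δ : ℝ) (hC : 0 ≤ C) (hδ : 0 < δ)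
    (hP1 : ∀ u, ‖(P u : H)‖ ≤ C * ‖u‖) (hP2 : ∀ u, ‖A (P u)‖ ≤ C * ‖u‖)
    (hP : ∀ u, δ * ‖u‖ ^ 2 ≤ (⟪u - (2 : ℂ) • (P u : H), M u⟫).re) :
    ∃ t K : ℝ, 0 ≤ t ∧ 0 ≤ K ∧ ∀ s : ℝ, |s| = t → ∀ x : A.domain,
      ‖(x : H)‖ ≤ K * ‖A x - (Complex.I * s) • (x : H)‖ := by
  refine ⟨(1 + 2 * C * ‖M‖) / δ, (1 + 2 * C) * ‖M‖, by positivity, by positivity, ?_⟩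
  intro s hs x
  set y := A x - (Complex.I * s) • (x : H) with hy
  set w := ⟪(x : H) - (2 : ℂ) • (P x : H), M x⟫ with hw
  have h1 : ⟪(x : H) - (2 : ℂ) • (P x : H), M y⟫ =
      ⟪(x : H), M (A x)⟫ - 2 * ⟪A (P x), M x⟫ - Complex.I * s * w := by
    rw [hy, hsym, map_sub, inner_sub_right, map_smul, inner_smul_right, ← hw, inner_sub_left,
      inner_smul_left]
    have h2 : (starRingEnd ℂ) (2 : ℂ) = 2 := Complex.conj_ofNat 2
    rw [h2]
  have h2 : (⟪(x : H), M (A x)⟫).im = 0 := by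
    have h : star (⟪(x : H), M (A x)⟫) = ⟪(x : H), M (A x)⟫ := by
      have h := inner_conj_symm (𝕜 := ℂ) (M (A x)) (x : H)
      have h' := inner_conj_symm (𝕜 := ℂ) (x : H) (M (A x))
      change (starRingEnd ℂ) _ = _
      rw [h, hM, hsym]
    exact Complex.conj_eq_iff_im.1 h
  have h3 : (⟪(x : H) - (2 : ℂ) • (P x : H), M y⟫).im = - 2 * (⟪A (P x), M x⟫).im - s * w.re := by
    rw [h1]; simp [h2]
  have h4 : |(⟪A (P x), M x⟫).im| ≤ C * ‖M‖ * ‖(x : H)‖ ^ 2 := by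
    refine (Complex.abs_im_le_norm _).trans ((norm_inner_le_norm _ _).trans ?_)
    refine (mul_le_mul (hP2 x) (M.le_opNorm _) (norm_nonneg _) (by positivity)).trans (le_of_eq ?_)
    ring
  have h5 : ‖⟪(x : H) - (2 : ℂ) • (P x : H), M y⟫‖ ≤ (1 + 2 * C) * ‖(x : H)‖ * (‖M‖ * ‖y‖) := by
    refine (norm_inner_le_norm _ _).trans ?_
    refine mul_le_mul ?_ (M.le_opNorm _) (norm_nonneg _) (by positivity)
    refine (norm_sub_le _ _).trans ?_
    rw [norm_smul]
    have := hP1 x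
    simp only [Complex.norm_ofNat]
    linarith
  have h6 : (1 + 2 * C * ‖M‖) * ‖(x : H)‖ ^ 2 ≤ |s * w.re| := by
    rw [abs_mul, hs, div_mul_eq_mul_div, le_div_iff₀ hδ, mul_assoc]
    refine mul_le_mul_of_nonneg_left ?_ (by positivity)
    rw [mul_comm]
    exact (hP x).trans (le_abs_self _)
  have h7 : ‖(x : H)‖ ^ 2 ≤ (1 + 2 * C) * ‖(x : H)‖ * (‖M‖ * ‖y‖) := by
    refine le_trans ?_ ((Complex.abs_im_le_norm _).trans h5)
    rw [h3]
    have h8 : |s * w.re| ≤ |(- 2 * (⟪A (P x), M x⟫).im - s * w.re)| + 2 * |(⟪A (P x), M x⟫).im| := by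
      set g := (⟪A (P x), M x⟫).im
      rcases abs_cases (s * w.re) with h | h <;> rcases abs_cases g with h' | h' <;>
        rcases abs_cases (-2 * g - s * w.re) with h'' | h'' <;> linarith
    nlinarith
  rcases (norm_nonneg (x : H)).eq_or_lt with h0 | h0
  · rw [← h0]; positivity
  · refine le_of_mul_le_mul_left ?_ h0
    nlinarith

lemma resolvent_exists {H : Type*} [NormedAddCommGroup H] [InnerProductSpace ℂ H] [CompleteSpace H]
    (M : H →L[ℂ] H) (hM : ∀ u v, ⟪M u, v⟫ = ⟪u, M v⟫) (hMunit : IsUnit M)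
    (A : H →ₗ.[ℂ] H)
    (hSA : ∀ u w : H,
      (∃ h : u ∈ A.domain, A ⟨u, h⟩ = w) ↔
        ∀ x : A.domain, ⟪A x, M u⟫ = ⟪(x : H), M w⟫)
    (t K : ℝ) (hK : 0 ≤ K) (hb : ∀ s : ℝ, |s| = |t| → ∀ x : A.domain,
      ‖(x : H)‖ ≤ K * ‖A x - (Complex.I * s) • (x : H)‖) :
    ∃ z : ℂ, ∃ R : H →L[ℂ] H,
      (∀ u : H, ∃ h : R u ∈ A.domain, A ⟨R u, h⟩ - z • R u = u) ∧
      (∀ x : A.domain, R (A x - z • (x : H)) = (x : H)) := by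
  set z : ℂ := Complex.I * t with hz
  have hb1 := hb t rfl
  have hb2 := hb (-t) (abs_neg t)
  let L : A.domain →ₗ[ℂ] H := A.toFun - z • A.domain.subtype
  have hL : ∀ x : A.domain, L x = A x - z • (x : H) := fun x => rfl
  have hLb : ∀ x : A.domain, ‖(x : H)‖ ≤ K * ‖L x‖ := fun x => hb1 x
  have hinj : Function.Injective L := by
    rw [injective_iff_map_eq_zero]
    intro x hx
    have := hLb x
    rw [hx] at this
    have h0 : (x : H) = 0 := by simpa using this
    exact Subtype.ext h0
  have hcl : IsClosed (LinearMap.range L : Set H) := by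
    refine IsSeqClosed.isClosed ?_
    intro y y0 hy hlim
    choose x hx using hy
    have hxc : CauchySeq (fun n => (x n : H)) := by
      have hyc := hlim.cauchySeq
      rw [Metric.cauchySeq_iff] at hyc ⊢
      intro ε hε
      obtain ⟨N, hN⟩ := hyc (ε / (K + 1)) (by positivity)
      refine ⟨N, fun m hm n hn => ?_⟩
      have h1 := hN m hm n hn
      have h2 := hLb (x m - x n)
      rw [map_sub, hx, hx, ← dist_eq_norm, AddSubgroupClass.coe_sub, ← dist_eq_norm] at h2
      rw [lt_div_iff₀ (by positivity)] at h1
      have := dist_nonneg (x := y m) (y := y n)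
      nlinarith
    obtain ⟨x0, hx0⟩ := cauchySeq_tendsto_of_complete hxc
    have hAx : Filter.Tendsto (fun n => A (x n)) Filter.atTop (nhds (y0 + z • x0)) := by
      have := hlim.add (hx0.const_smul z)
      refine this.congr fun n => ?_
      rw [← hx n, hL]; simp
    obtain ⟨h, hA⟩ := (hSA x0 (y0 + z • x0)).2 (by
      intro x'
      have l1 : Filter.Tendsto (fun n => ⟪A x', M (x n)⟫) Filter.atTop (nhds ⟪A x', M x0⟫) :=
        Filter.Tendsto.inner tendsto_const_nhds ((M.continuous.tendsto _).comp hx0)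
      have l2 : Filter.Tendsto (fun n => ⟪(x' : H), M (A (x n))⟫) Filter.atTop
          (nhds ⟪(x' : H), M (y0 + z • x0)⟫) :=
        Filter.Tendsto.inner tendsto_const_nhds ((M.continuous.tendsto _).comp hAx)
      refine tendsto_nhds_unique l1 (l2.congr fun n => ?_)
      exact ((hSA (x n) (A (x n))).1 ⟨(x n).2, rfl⟩ x').symm)
    exact ⟨⟨x0, h⟩, by rw [hL, hA]; simp⟩
  have hsurj : Function.Surjective L := by
    rw [← LinearMap.range_eq_top]
    have : CompleteSpace (LinearMap.range L) := hcl.completeSpace_coe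
    rw [← Submodule.orthogonal_eq_bot_iff, eq_bot_iff]
    intro w hw
    obtain ⟨Mu, rfl⟩ := hMunit
    let u : H := (↑(Mu⁻¹) : H →L[ℂ] H) w
    have hu : (Mu : H →L[ℂ] H) u = w := by
      have := congrArg (fun f : H →L[ℂ] H => f w) (Mu.mul_inv)
      exact this
    obtain ⟨h, hA⟩ := (hSA u ((Complex.I * ((-t : ℝ) : ℂ)) • u)).2 (by
      intro x
      have h1 : ⟪L x, w⟫ = 0 := hw _ ⟨x, rfl⟩
      rw [hL, inner_sub_left, inner_smul_left, sub_eq_zero] at h1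
      rw [hu, map_smul, hu, inner_smul_right, h1, hz]
      simp)
    have h2 := hb2 ⟨u, h⟩
    rw [hA] at h2
    have h3 : u = 0 := by simpa using h2
    rw [Submodule.mem_bot, ← hu, h3, map_zero]
  let E := LinearEquiv.ofBijective L ⟨hinj, hsurj⟩
  have hE : ∀ x, E x = L x := fun x => rfl
  let R : H →L[ℂ] H := LinearMap.mkContinuous (A.domain.subtype ∘ₗ E.symm.toLinearMap) K (by
    intro u
    have := hLb (E.symm u)
    rwa [← hE, E.apply_symm_apply] at this)
  have hR : ∀ u, R u = (E.symm u : H) := fun u => rfl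
  refine ⟨z, R, fun u => ⟨(E.symm u).2, ?_⟩, fun x => ?_⟩
  · have := E.apply_symm_apply u
    rw [hE, hL] at this
    exact this
  · rw [hR, ← hL, ← hE, E.symm_apply_apply]

lemma compress_exists {H : Type*} [NormedAddCommGroup H] [InnerProductSpace ℂ H]
    (M : H →L[ℂ] H) (A : H →ₗ.[ℂ] H) (D : Submodule ℂ H) [FiniteDimensional ℂ D]
    (hD : D ≤ A.domain)
    (hnd : ∀ d ∈ D, (∀ x ∈ D, ⟪x, M d⟫ = 0) → d = 0) :
    ∃ B : Module.End ℂ D, ∀ x y : D, ⟪(x : H), M (B y : H)⟫ = ⟪(x : H), M (A ⟨y, hD y.2⟩)⟫ := by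
  let pr : H →ₗ[ℂ] D := (D.orthogonalProjectionOnto : H →L[ℂ] D)
  have hpr : ∀ (x : D) (w : H), ⟪(x : H), (pr w : H)⟫ = ⟪(x : H), w⟫ := fun x w => by
    have := D.sub_starProjection_mem_orthogonal w x x.2
    rw [inner_sub_right, sub_eq_zero] at this
    exact this.symm
  let Φ : Module.End ℂ D := pr ∘ₗ M.toLinearMap ∘ₗ D.subtype
  have hΦ : ∀ x y : D, ⟪(x : H), (Φ y : H)⟫ = ⟪(x : H), M y⟫ := fun x y => hpr x (M y)
  have hinj : Function.Injective Φ := by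
    rw [injective_iff_map_eq_zero]
    intro d hd
    refine Subtype.ext (hnd d d.2 fun x hx => ?_)
    rw [← hΦ ⟨x, hx⟩ d, hd]; simp
  let E := LinearEquiv.ofInjectiveEndo Φ hinj
  let Am : D →ₗ[ℂ] H := A.toFun ∘ₗ Submodule.inclusion hD
  refine ⟨E.symm.toLinearMap ∘ₗ pr ∘ₗ M.toLinearMap ∘ₗ Am, fun x y => ?_⟩
  rw [← hΦ]
  have : Φ ((E.symm.toLinearMap ∘ₗ pr ∘ₗ M.toLinearMap ∘ₗ Am) y) = pr (M (Am y)) :=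
    E.apply_symm_apply _
  rw [this, hpr]
  rfl

lemma fd_step {H : Type*} [NormedAddCommGroup H] [InnerProductSpace ℂ H]
    (M : H →L[ℂ] H) (hM : ∀ u v, ⟪M u, v⟫ = ⟪u, M v⟫)
    (F : Submodule ℂ H) [FiniteDimensional ℂ F]
    (c : ℝ) (hc : 0 < c)
    (hpos : ∀ u ∈ Fᗮ, c * ‖u‖ ^ 2 ≤ (⟪u, M u⟫).re)
    (A : H →ₗ.[ℂ] H)
    (hsym : ∀ x y : A.domain, ⟪A x, M y⟫ = ⟪(x : H), M (A y)⟫)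
    (D : Submodule ℂ H) [FiniteDimensional ℂ D]
    (hD : D ≤ A.domain)
    (hnd : ∀ d ∈ D, (∀ x ∈ D, ⟪x, M d⟫ = 0) → d = 0) (k : ℕ) (hk : Module.finrank ℂ F ≤ k) :
    ∃ q : Polynomial ℂ, q ≠ 0 ∧ q.natDegree ≤ k ∧ ∀ v : ℕ → H, (∀ j ≤ k, v j ∈ D) →
      (∀ j < k, ∃ h : v j ∈ A.domain, v (j + 1) = A ⟨v j, h⟩) →
      0 ≤ (⟪∑ j ∈ Finset.range (k + 1), q.coeff j • v j,
        M (∑ j ∈ Finset.range (k + 1), q.coeff j • v j)⟫).re := by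
  obtain ⟨B, hB⟩ := compress_exists M A D hD hnd
  let G : D →ₗ⋆[ℂ] D →ₗ[ℂ] ℂ := LinearMap.mk₂'ₛₗ (starRingEnd ℂ) (RingHom.id ℂ)
    (fun u v : D => ⟪(u : H), M (v : H)⟫) (by intros; simp)
    (by intros; simp [mul_comm]) (by intros; simp)
    (by intros; simp)
  have hGdef : ∀ u v : D, G u v = ⟪(u : H), M (v : H)⟫ := fun u v => rfl
  have hG : ∀ u v, star (G u v) = G v u := by
    intro u v
    rw [hGdef, hGdef, ← hM v u]
    exact inner_conj_symm _ _
  have hGB : ∀ u v, G (B u) v = G u (B v) := by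
    intro u v
    rw [← hG, hGdef u, hGdef v, hB, hB, ← hsym ⟨u, hD u.2⟩ ⟨v, hD v.2⟩]
    change (starRingEnd ℂ) _ = _
    rw [inner_conj_symm, hM]
  obtain ⟨q, hq0, hqk, hq⟩ := fd_pontryagin G hG B hGB (Module.finrank ℂ (⊤ : Submodule ℂ D) + 1) k ⊤
    (Nat.lt_succ_self _) (fun _ _ => Submodule.mem_top) (by
      intro N _ hN _
      refine le_trans ?_ hk
      let f : N →ₗ[ℂ] F := (F.orthogonalProjectionOnto : H →L[ℂ] F).toLinearMap ∘ₗ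
        D.subtype ∘ₗ N.subtype
      refine LinearMap.finrank_le_finrank_of_injective (f := f) ?_
      rw [injective_iff_map_eq_zero]
      intro x hx
      have h1 : ((x : D) : H) ∈ Fᗮ := by
        have h2 := F.sub_starProjection_mem_orthogonal ((x : D) : H)
        have h3 : F.starProjection ((x : D) : H) = 0 := congrArg Subtype.val hx
        rwa [h3, sub_zero] at h2
      have h2 := hpos _ h1
      have h3 := hN x x.2
      rw [hGdef] at h3
      have h4 : ‖((x : D) : H)‖ ^ 2 ≤ 0 := by nlinarith
      have h5 : ((x : D) : H) = 0 := by
        have := le_antisymm h4 (sq_nonneg _)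
        simpa using this
      exact Subtype.ext (Subtype.ext h5))
  refine ⟨q, hq0, hqk, fun v hv hch => ?_⟩
  have hpow : ∀ j ≤ k, (((B ^ j) ⟨v 0, hv 0 (Nat.zero_le _)⟩ : D) : H) = v j := by
    intro j
    induction j with
    | zero => intro _; simp
    | succ j ih =>
      intro hj
      have h1 := ih (by omega)
      rw [pow_succ', Module.End.mul_apply]
      set y := (B ^ j) ⟨v 0, hv 0 (Nat.zero_le _)⟩ with hy
      obtain ⟨h, hA⟩ := hch j (by omega)
      have h2 : (⟨y, hD y.2⟩ : A.domain) = ⟨v j, h⟩ := Subtype.ext h1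
      have h3 : ((B y : D) : H) - v (j + 1) = 0 := by
        refine hnd _ (D.sub_mem (B y).2 (hv _ hj)) fun x hx => ?_
        rw [map_sub, inner_sub_right, hB ⟨x, hx⟩ y, h2, hA]
        simp
      exact sub_eq_zero.1 h3
  have h1 : ((Polynomial.aeval B q ⟨v 0, hv 0 (Nat.zero_le _)⟩ : D) : H)
      = ∑ j ∈ Finset.range (k + 1), q.coeff j • v j := by
    rw [Polynomial.aeval_eq_sum_range' (n := k + 1) (by omega)]
    simp only [LinearMap.sum_apply, LinearMap.smul_apply, AddSubmonoidClass.coe_finsetSum,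
      Submodule.coe_smul]
    refine Finset.sum_congr rfl fun j hj => ?_
    rw [hpow j (by simpa [Nat.lt_succ_iff] using hj)]
  have h2 := hq ⟨v 0, hv 0 (Nat.zero_le _)⟩ Submodule.mem_top
  rw [hGdef, h1] at h2
  exact h2

lemma exists_q {H : Type*} [NormedAddCommGroup H] [InnerProductSpace ℂ H]
    (M : H →L[ℂ] H) (hM : ∀ u v, ⟪M u, v⟫ = ⟪u, M v⟫)
    (F : Submodule ℂ H) [FiniteDimensional ℂ F]
    (c : ℝ) (hc : 0 < c)
    (hpos : ∀ u ∈ Fᗮ, c * ‖u‖ ^ 2 ≤ (⟪u, M u⟫).re)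
    (A : H →ₗ.[ℂ] H)
    (hsym : ∀ x y : A.domain, ⟪A x, M y⟫ = ⟪(x : H), M (A y)⟫)
    (P : H →ₗ[ℂ] A.domain) (δ : ℝ) (hδ : 0 < δ) (hPfin : FiniteDimensional ℂ (LinearMap.range P))
    (hP : ∀ u, δ * ‖u‖ ^ 2 ≤ (⟪u - (2 : ℂ) • (P u : H), M u⟫).re)
    (k : ℕ) (hk : Module.finrank ℂ F ≤ k) :
    ∃ q : Polynomial ℂ, q ≠ 0 ∧ q.natDegree ≤ k ∧ ∀ v : ℕ → H, (∀ j ≤ k, v j ∈ A.domain) →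
      (∀ j < k, ∃ h : v j ∈ A.domain, v (j + 1) = A ⟨v j, h⟩) →
      0 ≤ (⟪∑ j ∈ Finset.range (k + 1), q.coeff j • v j,
        M (∑ j ∈ Finset.range (k + 1), q.coeff j • v j)⟫).re := by
  let ι := {v : ℕ → H // (∀ j ≤ k, v j ∈ A.domain) ∧
      (∀ j < k, ∃ h : v j ∈ A.domain, v (j + 1) = A ⟨v j, h⟩)}
  let S : (Fin (k + 1) → ℂ) → (ℕ → H) → H := fun a v => ∑ j : Fin (k + 1), a j • v j
  let t : ι → Set (Fin (k + 1) → ℂ) := fun v => {a | 0 ≤ (⟪S a v.1, M (S a v.1)⟫).re}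
  have hScont : ∀ v, Continuous fun a => S a v := fun v => by fun_prop
  have ht : ∀ i, IsClosed (t i) := fun v =>
    isClosed_le continuous_const (Complex.continuous_re.comp
      ((hScont v.1).inner (M.continuous.comp (hScont v.1))))
  have hcomp : IsCompact (Metric.sphere (0 : Fin (k + 1) → ℂ) 1) := isCompact_sphere _ _
  have hfip : ∀ s : Finset ι, (Metric.sphere (0 : Fin (k + 1) → ℂ) 1 ∩ ⋂ i ∈ s, t i).Nonempty := by
    intro s
    let X : Set H := ⋃ i ∈ s, (fun j => i.1 j) '' (Finset.range (k + 1) : Set ℕ)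
    have hXfin : X.Finite := s.finite_toSet.biUnion fun i _ => (Finset.finite_toSet _).image _
    let D : Submodule ℂ H := Submodule.span ℂ X ⊔ (LinearMap.range P).map A.domain.subtype
    have : FiniteDimensional ℂ (Submodule.span ℂ X) := FiniteDimensional.span_of_finite ℂ hXfin
    have hDfin : FiniteDimensional ℂ D := by
      infer_instance
    have hD : D ≤ A.domain := by
      refine sup_le (Submodule.span_le.2 ?_) ?_
      · intro x hx
        simp only [X, Set.mem_iUnion] at hx
        obtain ⟨i, _, j, hj, rfl⟩ := hx
        exact i.2.1 j (by simpa [Nat.lt_succ_iff] using hj)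
      · rintro _ ⟨x, _, rfl⟩
        exact x.2
    have hPD : ∀ u, (P u : H) ∈ D := fun u =>
      (le_sup_right : _ ≤ D) ⟨P u, ⟨u, rfl⟩, rfl⟩
    have hnd : ∀ d ∈ D, (∀ x ∈ D, ⟪x, M d⟫ = 0) → d = 0 := by
      intro d hd h
      have h1 := hP d
      rw [h _ (D.sub_mem hd (D.smul_mem _ (hPD d))), Complex.zero_re] at h1
      have h4 : ‖d‖ ^ 2 ≤ 0 := by nlinarith
      have := le_antisymm h4 (sq_nonneg _)
      simpa using this
    obtain ⟨q, hq0, hqk, hq⟩ := fd_step M hM F c hc hpos A hsym D hD hnd k hk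
    let a : Fin (k + 1) → ℂ := fun j => q.coeff j
    have ha : a ≠ 0 := by
      intro h0
      apply hq0
      ext j
      by_cases hj : j < k + 1
      · exact congrFun h0 ⟨j, hj⟩
      · rw [Polynomial.coeff_eq_zero_of_natDegree_lt (by omega)]; simp
    have hna : 0 < ‖a‖ := norm_pos_iff.2 ha
    refine ⟨((‖a‖⁻¹ : ℝ) : ℂ) • a, ?_, ?_⟩
    · simp [norm_smul, hna.ne']
    · simp only [Set.mem_iInter]
      intro i hi
      have h1 := hq i.1 (fun j hj => (le_sup_left : _ ≤ D) (Submodule.subset_span (by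
        simp only [X, Set.mem_iUnion]
        exact ⟨i, hi, j, by simpa [Nat.lt_succ_iff] using hj, rfl⟩))) i.2.2
      have h2 : S a i.1 = ∑ j ∈ Finset.range (k + 1), q.coeff j • i.1 j :=
        (Finset.sum_range (fun j => q.coeff j • i.1 j)).symm
      have h3 : S (((‖a‖⁻¹ : ℝ) : ℂ) • a) i.1 = ((‖a‖⁻¹ : ℝ) : ℂ) • S a i.1 := by
        simp only [S, Finset.smul_sum, Pi.smul_apply, smul_eq_mul, mul_smul]
      change 0 ≤ (⟪S _ i.1, M (S _ i.1)⟫).re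
      rw [h3, map_smul, inner_smul_left, inner_smul_right, Complex.conj_ofReal,
        Complex.re_ofReal_mul, Complex.re_ofReal_mul, h2]
      positivity
  obtain ⟨a, ha1, ha2⟩ := hcomp.inter_iInter_nonempty t ht hfip
  have hco : ∀ j : Fin (k + 1), (Polynomial.ofFn (k + 1) a).coeff j = a j := fun j => by
    rw [Polynomial.ofFn_coeff_eq_val_of_lt a j.2]
  refine ⟨Polynomial.ofFn (k + 1) a, ?_, ?_, fun v hv hch => ?_⟩
  · intro h0
    have : a = 0 := by
      ext j
      rw [← hco j, h0]; simp
    simp [this] at ha1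
  · exact Nat.lt_succ_iff.1 (Polynomial.ofFn_natDegree_lt (by omega) a)
  · have h1 : 0 ≤ (⟪S a v, M (S a v)⟫).re := Set.mem_iInter.1 ha2 ⟨v, hv, hch⟩
    have h2 : S a v = ∑ j ∈ Finset.range (k + 1), (Polynomial.ofFn (k + 1) a).coeff j • v j := by
      rw [Finset.sum_range]
      exact Finset.sum_congr rfl fun j _ => by rw [hco j]
    rwa [h2] at h1

lemma coeff_mul_sum (f g : Polynomial ℂ) (n : ℕ) (hf : f.natDegree ≤ n) (hg : g.natDegree ≤ n)
    (t : ℕ → ℂ) : ∑ k ∈ Finset.range (2 * n + 1), (f * g).coeff k * t k =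
      ∑ i ∈ Finset.range (n + 1), ∑ j ∈ Finset.range (n + 1), f.coeff i * g.coeff j * t (i + j) := by
  let L : Polynomial ℂ →ₗ[ℂ] ℂ := Polynomial.lsum fun k => LinearMap.mulRight ℂ (t k)
  have hL : ∀ p : Polynomial ℂ, p.natDegree ≤ 2 * n →
      L p = ∑ k ∈ Finset.range (2 * n + 1), p.coeff k * t k := by
    intro p hp
    exact Polynomial.sum_over_range' p (fun _ => map_zero _) _ (by omega)
  have hLm : ∀ k a, L (Polynomial.monomial k a) = a * t k := by
    intro k a
    exact Polynomial.sum_monomial_index (S := ℂ) (n := k) a (fun k x => x * t k) (zero_mul _)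
  rw [← hL _ (Polynomial.natDegree_mul_le.trans (by omega))]
  conv_lhs => rw [f.as_sum_range' (n + 1) (by omega), g.as_sum_range' (n + 1) (by omega),
    Finset.sum_mul_sum]
  simp only [map_sum, Polynomial.monomial_mul_monomial, hLm]

lemma exists_real_poly (r : Polynomial ℂ) : ∃ p : Polynomial ℝ,
    p.map (algebraMap ℝ ℂ) = r.map (starRingEnd ℂ) * r := by
  have : r.map (starRingEnd ℂ) * r ∈ Polynomial.lifts (algebraMap ℝ ℂ) := by
    rw [Polynomial.lifts_iff_coeff_lifts]
    intro k
    have h1 : (r.map (starRingEnd ℂ) * r).map (starRingEnd ℂ) = r.map (starRingEnd ℂ) * r := by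
      rw [Polynomial.map_mul, Polynomial.map_map]
      simp [mul_comm]
    have h2 := congrArg (fun f => f.coeff k) h1
    simp only [Polynomial.coeff_map] at h2
    obtain ⟨x, hx⟩ := Complex.conj_eq_iff_real.1 h2
    exact ⟨x, hx.symm⟩
  exact (Polynomial.mem_lifts _).1 this

lemma exists_p {H : Type*} [NormedAddCommGroup H] [InnerProductSpace ℂ H]
    (M : H →L[ℂ] H) (hM : ∀ u v, ⟪M u, v⟫ = ⟪u, M v⟫)
    (A : H →ₗ.[ℂ] H)
    (hsym : ∀ x y : A.domain, ⟪A x, M y⟫ = ⟪(x : H), M (A y)⟫)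
    (k : ℕ) (q : Polynomial ℂ) (hq0 : q ≠ 0) (hqk : q.natDegree ≤ k)
    (hq : ∀ v : ℕ → H, (∀ j ≤ k, v j ∈ A.domain) →
      (∀ j < k, ∃ h : v j ∈ A.domain, v (j + 1) = A ⟨v j, h⟩) →
      0 ≤ (⟪∑ j ∈ Finset.range (k + 1), q.coeff j • v j,
        M (∑ j ∈ Finset.range (k + 1), q.coeff j • v j)⟫).re) :
    (∃ p : Polynomial ℝ, p ≠ 0 ∧ Even p.natDegree ∧
      ∀ (u : H) (v : ℕ → H), v 0 = u →
        (∀ j < p.natDegree, ∃ h : v j ∈ A.domain, v (j + 1) = A ⟨v j, h⟩) →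
        0 ≤ (⟪u, M (∑ j ∈ Finset.range (p.natDegree + 1), p.coeff j • v j)⟫).re ∧
          (⟪u, M (∑ j ∈ Finset.range (p.natDegree + 1), p.coeff j • v j)⟫).im = 0) := by
  set n := k + 1 with hn
  set m := n - q.natDegree with hm
  set r : Polynomial ℂ := q * Polynomial.X ^ m with hr
  have hr0 : r ≠ 0 := mul_ne_zero hq0 (pow_ne_zero _ Polynomial.X_ne_zero)
  have hrn : r.natDegree = n := by
    rw [hr, Polynomial.natDegree_mul_X_pow _ hq0]; omega
  set rc := r.map (starRingEnd ℂ) with hrc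
  have hrcn : rc.natDegree = n := by rw [hrc, Polynomial.natDegree_map, hrn]
  have hrc0 : rc ≠ 0 := (Polynomial.map_ne_zero_iff (starRingEnd ℂ).injective).2 hr0
  obtain ⟨p, hp⟩ := exists_real_poly r
  have hpn : p.natDegree = 2 * n := by
    rw [← Polynomial.natDegree_map (algebraMap ℝ ℂ), hp, ← hrc,
      Polynomial.natDegree_mul hrc0 hr0, hrn, hrcn]
    ring
  refine ⟨p, ?_, ?_, ?_⟩
  · rintro rfl
    rw [Polynomial.map_zero] at hp
    exact mul_ne_zero hrc0 hr0 hp.symm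
  · rw [hpn]; exact even_two_mul n
  rw [hpn]
  rintro u v rfl hch
  have htr : ∀ i j, i + j ≤ 2 * n → ⟪v i, M (v j)⟫ = ⟪v 0, M (v (i + j))⟫ := by
    intro i
    induction i with
    | zero => intro j _; simp
    | succ i ih =>
      intro j hij
      obtain ⟨h1, h2⟩ := hch i (by omega)
      obtain ⟨h3, h4⟩ := hch j (by omega)
      have := ih (j + 1) (by omega)
      rw [h2, hsym ⟨v i, h1⟩ ⟨v j, h3⟩, ← h4, this]
      congr 3
      omega
  set s : H := ∑ i ∈ Finset.range (n + 1), r.coeff i • v i with hs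
  have key : ⟪v 0, M (∑ j ∈ Finset.range (2 * n + 1), p.coeff j • v j)⟫ = ⟪s, M s⟫ := by
    have h1 : ⟪v 0, M (∑ j ∈ Finset.range (2 * n + 1), p.coeff j • v j)⟫ =
        ∑ j ∈ Finset.range (2 * n + 1), (rc * r).coeff j * ⟪v 0, M (v j)⟫ := by
      rw [map_sum, inner_sum]
      refine Finset.sum_congr rfl fun j _ => ?_
      rw [← hp, Polynomial.coeff_map, ← inner_smul_right, ← map_smul]
      rfl
    rw [h1, coeff_mul_sum rc r n hrcn.le hrn.le, hs, map_sum, sum_inner]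
    refine Finset.sum_congr rfl fun i hi => ?_
    rw [inner_sum]
    refine Finset.sum_congr rfl fun j hj => ?_
    rw [Finset.mem_range] at hi hj
    rw [map_smul, inner_smul_left, inner_smul_right, htr i j (by omega), hrc,
      Polynomial.coeff_map]
    ring
  have hs2 : s = ∑ j ∈ Finset.range (k + 1), q.coeff j • v (m + j) := by
    have h1 : s = ∑ i ∈ Finset.range (m + (k + 1)), r.coeff i • v i := by
      refine Finset.sum_subset (Finset.range_subset_range.2 (by omega)) fun i _ hi => ?_
      rw [Finset.mem_range, not_lt] at hi
      rw [Polynomial.coeff_eq_zero_of_natDegree_lt (by omega), zero_smul]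
    rw [h1, Finset.sum_range_add, Finset.sum_eq_zero, zero_add]
    · refine Finset.sum_congr rfl fun j _ => ?_
      rw [hr, add_comm m j, Polynomial.coeff_mul_X_pow]
    · intro i hi
      rw [Finset.mem_range] at hi
      rw [hr, Polynomial.coeff_mul_X_pow', if_neg (by omega), zero_smul]
  rw [key]
  constructor
  · rw [hs2]
    refine hq (fun j => v (m + j)) (fun j hj => (hch (m + j) (by omega)).1) fun j hj => ?_
    exact hch (m + j) (by omega)
  · refine Complex.conj_eq_iff_im.1 ?_
    rw [inner_conj_symm, hM]

/-- **Selfadjoint operators on Pontryagin spaces are definitizable with an even-degree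
definitizing polynomial** (Theorem B.2).

The Pontryagin structure is expressed via a finite-dimensional `M`-invariant subspace `F` on
which the Krein form `[u,v] = ⟪u, M v⟫` is uniformly negative, while it is uniformly positive
on the Hilbert orthogonal complement of `F`. Krein selfadjointness of the densely defined
operator `A`, i.e. `A = M⁻¹ A* M`, is expressed by the graph characterization
`(u, w) ∈ Graph A ↔ (M u, M w) ∈ Graph A*`. Membership of `u` in `Dom (A ^ deg p)` together
with the value `p(A) u` is expressed through a chain `v 0 = u`, `v (j+1) = A (v j)`. -/
theorem pontryagin_selfadjoint_definitizable
    {H : Type*} [NormedAddCommGroup H] [InnerProductSpace ℂ H] [CompleteSpace H]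
    (M : H →L[ℂ] H) (hM : IsSelfAdjoint M) (hMunit : IsUnit M)
    (F : Submodule ℂ H) (hFfin : FiniteDimensional ℂ F)
    (hMF : ∀ u ∈ F, M u ∈ F)
    (c : ℝ) (hc : 0 < c)
    (hneg : ∀ u ∈ F, (⟪u, M u⟫).re ≤ -c * ‖u‖ ^ 2)
    (hpos : ∀ u ∈ Fᗮ, c * ‖u‖ ^ 2 ≤ (⟪u, M u⟫).re)
    (A : H →ₗ.[ℂ] H) (hdense : Dense (A.domain : Set H))
    -- Krein selfadjointness: `A = M⁻¹ A* M`, i.e. `(u,w) ∈ Graph A ↔ (Mu, Mw) ∈ Graph A*`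
    (hSA : ∀ u w : H,
      (∃ h : u ∈ A.domain, A ⟨u, h⟩ = w) ↔
        ∀ x : A.domain, ⟪A x, M u⟫ = ⟪(x : H), M w⟫) :
    -- the resolvent set of `A` is nonempty
    (∃ z : ℂ, ∃ R : H →L[ℂ] H,
      (∀ u : H, ∃ h : R u ∈ A.domain, A ⟨R u, h⟩ - z • R u = u) ∧
      (∀ x : A.domain, R (A x - z • (x : H)) = (x : H))) ∧
    -- and `A` admits a real definitizing polynomial of even degree
    (∃ p : Polynomial ℝ, p ≠ 0 ∧ Even p.natDegree ∧
      ∀ (u : H) (v : ℕ → H), v 0 = u →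
        (∀ j < p.natDegree, ∃ h : v j ∈ A.domain, v (j + 1) = A ⟨v j, h⟩) →
        0 ≤ (⟪u, M (∑ j ∈ Finset.range (p.natDegree + 1), p.coeff j • v j)⟫).re ∧
          (⟪u, M (∑ j ∈ Finset.range (p.natDegree + 1), p.coeff j • v j)⟫).im = 0) := by
  have hM' : ∀ u v, ⟪M u, v⟫ = ⟪u, M v⟫ := fun u v => by
    rw [← ContinuousLinearMap.adjoint_inner_right, ContinuousLinearMap.isSelfAdjoint_iff'.1 hM]
  have hsym : ∀ x y : A.domain, ⟪A x, M y⟫ = ⟪(x : H), M (A y)⟫ := fun x y =>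
    (hSA y (A y)).1 ⟨y.2, rfl⟩ x
  obtain ⟨P, C, δ, hC, hδ, hPfin, hP1, hP2, hP⟩ :=
    exists_P M hM' F hMF c hc hneg hpos A hdense
  constructor
  · obtain ⟨t, K, ht, hK, hb⟩ := lower_bound M hM' A hsym P C δ hC hδ hP1 hP2 hP
    rw [← abs_of_nonneg ht] at hb
    exact resolvent_exists M hM' hMunit A hSA t K hK hb
  · obtain ⟨q, hq0, hqk, hq⟩ := exists_q M hM' F c hc hpos A hsym P δ hδ hPfin hP _ le_rfl
    exact exists_p M hM' A hsym _ q hq0 hqk hq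
end
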